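/- arXiv:1404.6263 — 5 statements merged into one kernel-verified Lean document; each statement's English description precedes it below -/
import Mathlib

section
/- The monad (T,η,μ) on BPos arising from the adjunction K ⊣ U (the Kalmbach monad) has multiplication given explicitly by μ_P([C₁<C₂<…<C_{2n}]) = C₁ Δ C₂ Δ … Δ C_{2n}, the symmetric difference of the chains C_i, for every chain [C₁<…<C_{2n}] of even length in T(P) = K(P). -/
attribute [local instance] Classical.propDecidable

universe u v w

/- Kalmbach extension machinery, parameterized by an explicit order relation. -/



/-- `C` is a finite chain with an even number of elements w.r.t. the order `r`. -/
def IsEvenChainR {α : Type u} (r : α → α → Prop) (C : Finset α) : Prop :=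
  (∀ a ∈ C, ∀ b ∈ C, r a b ∨ r b a) ∧ Even C.card

/-- `(a, b)` is one of the consecutive pairs `(x_{2i-1}, x_{2i})` of the even chain
`C = [x₁ < x₂ < … < x_{2n}]`: both belong to `C`, `a` occupies an odd position
(the number of elements of `C` below `a` is odd) and `b` is the immediate successor
of `a` in `C`. -/
def KalPairR {α : Type u} (r : α → α → Prop) (C : Finset α) (a b : α) : Prop :=
  a ∈ C ∧ b ∈ C ∧ r a b ∧ a ≠ b ∧
    Odd (C.filter fun y => r y a).card ∧
    (∀ c ∈ C, r a c → c ≠ a → r b c)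

/-- The Kalmbach order: `[x₁<x₂<…<x_{2n}] ≤ [y₁<y₂<…<y_{2k}]` iff for every `i`
there is `j` with `y_{2j-1} ≤ x_{2i-1} < x_{2i} ≤ y_{2j}`. -/
def KalLER {α : Type u} (r : α → α → Prop) (C D : Finset α) : Prop :=
  ∀ a b, KalPairR r C a b → ∃ c d, KalPairR r D c d ∧ r c a ∧ r b d

/-- The carrier of the Kalmbach extension `K(P)`: all finite chains with an even
number of elements (with elements taken from the carrier `S`). -/
def KalCarrier {α : Type u} (S : Set α) (r : α → α → Prop) : Set (Finset α) :=
  {C | ↑C ⊆ S ∧ IsEvenChainR r C}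

/-- Orthocomplementation on the Kalmbach extension: `C ↦ C Δ {0, 1}`. -/
noncomputable def kalComplF {α : Type u} (z u : α) (C : Finset α) : Finset α :=
  symmDiff C {z, u}

/-- The unit `η` of the Kalmbach adjunction: `η(0) = ∅` and `η(a) = [0 < a]` for `a > 0`. -/
noncomputable def kalEtaF {α : Type u} (z : α) (a : α) : Finset α :=
  if a = z then ∅ else {z, a}

/-- Symmetric difference of a finite family of finite sets:
`Δᵢ Cᵢ = {x | x belongs to an odd number of the Cᵢ}`. -/
noncomputable def kalMuF {α : Type u} (𝒞 : Finset (Finset α)) : Finset α :=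
  (𝒞.sup id).filter fun x => Odd (𝒞.filter fun C => x ∈ C).card

/-- `K(f)(C) = Δ_{x ∈ C} {f x}`, i.e. the set of `y` such that the number of
elements of `C` mapped to `y` is odd. -/
noncomputable def kalMapF {α : Type u} {β : Type v} (f : α → β) (C : Finset α) : Finset β :=
  (C.image f).filter fun y => Odd (C.filter fun x => f x = y).card

/-- Enumerate a finite chain in increasing order (w.r.t. `r`) as a list. -/
noncomputable def chainSortR {α : Type u} (r : α → α → Prop) (C : Finset α) : List α :=
  C.toList.mergeSort fun a b => decide (r a b)

/- Relative suprema/infima and orthomodular posets presented on a carrier set. -/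

/-- `z` is the least upper bound of `x` and `y` within the carrier `S`, w.r.t. `r`. -/
def RelLUB {α : Type u} (S : Set α) (r : α → α → Prop) (x y z : α) : Prop :=
  z ∈ S ∧ r x z ∧ r y z ∧ ∀ w ∈ S, r x w → r y w → r z w

/-- `z` is the greatest lower bound of `x` and `y` within the carrier `S`, w.r.t. `r`. -/
def RelGLB {α : Type u} (S : Set α) (r : α → α → Prop) (x y z : α) : Prop :=
  z ∈ S ∧ r z x ∧ r z y ∧ ∀ w ∈ S, r w x → r w y → r w z

/-- `(S, r, oc, z, u)` is an orthomodular poset: `(S, r, z, u)` is a bounded poset and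
`oc` is an orthocomplementation satisfying antitonicity, involutivity, `x ∧ x' = 0`,
existence of joins of orthogonal pairs, and the orthomodular law
`x ≤ y → x ∨ (x ∨ y')' = y`. -/
structure IsOrthomodularPosetOn {α : Type u} (S : Set α) (r : α → α → Prop)
    (oc : α → α) (z u : α) : Prop where
  bot_mem : z ∈ S
  top_mem : u ∈ S
  compl_mem : ∀ x ∈ S, oc x ∈ S
  refl : ∀ x ∈ S, r x x
  antisymm : ∀ x ∈ S, ∀ y ∈ S, r x y → r y x → x = y
  trans : ∀ x ∈ S, ∀ y ∈ S, ∀ w ∈ S, r x y → r y w → r x w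
  bot_le : ∀ x ∈ S, r z x
  le_top : ∀ x ∈ S, r x u
  compl_anti : ∀ x ∈ S, ∀ y ∈ S, r x y → r (oc y) (oc x)
  compl_compl : ∀ x ∈ S, oc (oc x) = x
  inf_compl : ∀ x ∈ S, RelGLB S r x (oc x) z
  sup_of_orth : ∀ x ∈ S, ∀ y ∈ S, r x (oc y) → ∃ j, RelLUB S r x y j
  orthomodular : ∀ x ∈ S, ∀ y ∈ S, r x y →
    ∃ j, RelLUB S r x (oc y) j ∧ RelLUB S r x (oc j) y

/-- A morphism of orthomodular posets (presented on carrier sets): it preserves the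
top element and, whenever `a ≤ b'`, it satisfies `φ a ≤ (φ b)'` and
`φ (a ∨ b) = φ a ∨ φ b`. -/
structure RelOMPHom {α : Type u} {β : Type v} (S₁ : Set α) (r₁ : α → α → Prop)
    (oc₁ : α → α) (t₁ : α) (S₂ : Set β) (r₂ : β → β → Prop) (oc₂ : β → β) (t₂ : β)
    (φ : α → β) : Prop where
  mem : ∀ x ∈ S₁, φ x ∈ S₂
  map_top : φ t₁ = t₂
  map_orth : ∀ a ∈ S₁, ∀ b ∈ S₁, r₁ a (oc₁ b) → r₂ (φ a) (oc₂ (φ b))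
  map_sup : ∀ a ∈ S₁, ∀ b ∈ S₁, r₁ a (oc₁ b) → ∀ j, RelLUB S₁ r₁ a b j →
      RelLUB S₂ r₂ (φ a) (φ b) (φ j)

section
attribute [-instance] Finset.decidableEq Finset.decidableMem

theorem kal_exists_max {α : Type u} (r : α → α → Prop) (hr : ∀ a, r a a)
    (ht : ∀ a b c, r a b → r b c → r a c) (C : Finset α) (hne : C.Nonempty)
    (hc : ∀ a ∈ C, ∀ b ∈ C, r a b ∨ r b a) : ∃ m ∈ C, ∀ y ∈ C, r y m := by
  induction hne using Finset.Nonempty.cons_induction with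
  | singleton a => exact ⟨a, by simp, by simp [hr]⟩
  | cons a s has hs ih =>
    obtain ⟨m, hm, hmax⟩ := ih (fun x hx y hy => hc x (by simp [hx]) y (by simp [hy]))
    rcases hc a (by simp) m (by simp [hm]) with h | h
    · refine ⟨m, by simp [hm], ?_⟩
      intro y hy
      rcases Finset.mem_cons.1 hy with rfl | hy
      · exact h
      · exact hmax y hy
    · refine ⟨a, by simp, ?_⟩
      intro y hy
      rcases Finset.mem_cons.1 hy with rfl | hy
      · exact hr _
      · exact ht _ _ _ (hmax y hy) h

theorem kal_exists_min {α : Type u} (r : α → α → Prop) (hr : ∀ a, r a a)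
    (ht : ∀ a b c, r a b → r b c → r a c) (C : Finset α) (hne : C.Nonempty)
    (hc : ∀ a ∈ C, ∀ b ∈ C, r a b ∨ r b a) : ∃ m ∈ C, ∀ y ∈ C, r m y :=
  kal_exists_max (fun a b => r b a) hr (fun a b c h1 h2 => ht _ _ _ h2 h1) C hne
    (fun a ha b hb => (hc a ha b hb).symm)

theorem kal_odd_symmDiff {α : Type u} (A B : Finset α) :
    Odd (symmDiff A B).card ↔ ¬ (Odd A.card ↔ Odd B.card) := by
  have h1 : (symmDiff A B).card = (A \ B).card + (B \ A).card := by
    rw [symmDiff_def, Finset.sup_eq_union, Finset.card_union_of_disjoint]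
    exact disjoint_sdiff_sdiff
  have h2 := Finset.card_sdiff_add_card_inter A B
  have h3 := Finset.card_sdiff_add_card_inter B A
  rw [Finset.inter_comm] at h3
  rw [h1, ← h2, ← h3]
  simp only [Nat.odd_iff]
  omega

theorem kal_odd_filter_symmDiff {α : Type u} (p : α → Prop) (A B : Finset α) :
    Odd ((symmDiff A B).filter p).card ↔
      ¬ (Odd (A.filter p).card ↔ Odd (B.filter p).card) := by
  rw [← kal_odd_symmDiff]
  have : (symmDiff A B).filter p = symmDiff (A.filter p) (B.filter p) := by
    ext x; simp only [Finset.mem_filter, Finset.mem_symmDiff]; tauto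
  rw [this]

/-- Parity of the number of elements of `C` below `x`. -/
def KOdd {α : Type u} (r : α → α → Prop) (C : Finset α) (x : α) : Prop :=
  Odd (C.filter fun y => r y x).card

theorem KOdd_symmDiff {α : Type u} (r : α → α → Prop) (A B : Finset α) (x : α) :
    KOdd r (symmDiff A B) x ↔ ¬ (KOdd r A x ↔ KOdd r B x) :=
  kal_odd_filter_symmDiff _ _ _

/-- A preorder that is antisymmetric on the carrier, with bounds. -/
structure KPO {α : Type u} (S : Set α) (r : α → α → Prop) (z u : α) : Prop where
  refl : ∀ a, r a a
  trans : ∀ a b c, r a b → r b c → r a c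
  anti : ∀ a ∈ S, ∀ b ∈ S, r a b → r b a → a = b
  zmem : z ∈ S
  umem : u ∈ S
  bot : ∀ a ∈ S, r z a
  top : ∀ a ∈ S, r a u
  ne : z ≠ u

section
variable {α : Type u} {S : Set α} {r : α → α → Prop} {z u : α}

theorem KPO.kodd_top (h : KPO S r z u) {C : Finset α} (hC : C ∈ KalCarrier S r) :
    ¬ KOdd r C u := by
  unfold KOdd
  rw [Finset.filter_true_of_mem (fun x hx => h.top x (hC.1 hx))]
  exact Nat.not_odd_iff_even.2 hC.2.2

theorem KPO.exists_pair (h : KPO S r z u) {C : Finset α} (hC : C ∈ KalCarrier S r)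
    {x : α} (hx : KOdd r C x) :
    ∃ a b, KalPairR r C a b ∧ r a x ∧ ¬ r b x := by
  have hne : (C.filter fun y => r y x).Nonempty := by
    rw [← Finset.card_pos]; exact hx.pos
  obtain ⟨a, ha, hmax⟩ := kal_exists_max r h.refl h.trans _ hne
    (fun p hp q hq => hC.2.1 p (Finset.mem_filter.1 hp).1 q (Finset.mem_filter.1 hq).1)
  obtain ⟨haC, hax⟩ := Finset.mem_filter.1 ha
  have hne2 : (C.filter fun y => ¬ r y x).Nonempty := by
    rw [Finset.nonempty_iff_ne_empty]
    intro he
    have : C.filter (fun y => r y x) = C := by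
      rw [Finset.filter_eq_self]
      intro y hy
      by_contra hn
      have : y ∈ C.filter fun y => ¬ r y x := Finset.mem_filter.2 ⟨hy, hn⟩
      rw [he] at this; simp at this
    unfold KOdd at hx
    rw [this] at hx
    exact Nat.not_odd_iff_even.2 hC.2.2 hx
  obtain ⟨b, hb, hmin⟩ := kal_exists_min r h.refl h.trans _ hne2
    (fun p hp q hq => hC.2.1 p (Finset.mem_filter.1 hp).1 q (Finset.mem_filter.1 hq).1)
  obtain ⟨hbC, hbx⟩ := Finset.mem_filter.1 hb
  have hab : r a b := by
    rcases hC.2.1 a haC b hbC with h1 | h1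
    · exact h1
    · exact absurd (h.trans _ _ _ h1 hax) hbx
  have hfe : (C.filter fun y => r y a) = C.filter fun y => r y x := by
    ext y; simp only [Finset.mem_filter]
    constructor
    · rintro ⟨h1, h2⟩; exact ⟨h1, h.trans _ _ _ h2 hax⟩
    · rintro ⟨h1, h2⟩; exact ⟨h1, hmax y (Finset.mem_filter.2 ⟨h1, h2⟩)⟩
  refine ⟨a, b, ⟨haC, hbC, hab, ?_, ?_, ?_⟩, hax, hbx⟩
  · rintro rfl; exact hbx hax
  · rw [hfe]; exact hx
  · intro c hc hac hca
    apply hmin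
    refine Finset.mem_filter.2 ⟨hc, fun hcx => hca ?_⟩
    exact h.anti _ (hC.1 hc) _ (hC.1 haC) (hmax c (Finset.mem_filter.2 ⟨hc, hcx⟩)) hac

theorem KPO.kodd_of_pair (h : KPO S r z u) {C : Finset α} (hC : C ∈ KalCarrier S r)
    {a b x : α} (hp : KalPairR r C a b) (hax : r a x) (hbx : ¬ r b x) : KOdd r C x := by
  obtain ⟨haC, hbC, hab, hne, hodd, hsucc⟩ := hp
  have hfe : (C.filter fun y => r y a) = C.filter fun y => r y x := by
    ext y; simp only [Finset.mem_filter]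
    constructor
    · rintro ⟨h1, h2⟩; exact ⟨h1, h.trans _ _ _ h2 hax⟩
    · rintro ⟨h1, h2⟩
      refine ⟨h1, ?_⟩
      by_contra hya
      have hay : r a y := (hC.2.1 a haC y h1).resolve_right hya
      have : y ≠ a := by rintro rfl; exact hya (h.refl _)
      exact hbx (h.trans _ _ _ (hsucc y h1 hay this) h2)
  unfold KOdd; rw [← hfe]; exact hodd

theorem KPO.kodd_pair_right (h : KPO S r z u) {C : Finset α} (hC : C ∈ KalCarrier S r)
    {a b : α} (hp : KalPairR r C a b) : ¬ KOdd r C b := by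
  obtain ⟨haC, hbC, hab, hne, hodd, hsucc⟩ := hp
  have hba : ¬ r b a := fun hba => hne (h.anti _ (hC.1 haC) _ (hC.1 hbC) hab hba)
  have hfe : (C.filter fun y => r y b) = insert b (C.filter fun y => r y a) := by
    ext y; simp only [Finset.mem_filter, Finset.mem_insert]
    constructor
    · rintro ⟨h1, h2⟩
      by_cases hya : r y a
      · exact Or.inr ⟨h1, hya⟩
      · left
        have hay : r a y := (hC.2.1 a haC y h1).resolve_right hya
        have : y ≠ a := by rintro rfl; exact hya (h.refl _)
        exact h.anti _ (hC.1 h1) _ (hC.1 hbC) h2 (hsucc y h1 hay this)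
    · rintro (rfl | ⟨h1, h2⟩)
      · exact ⟨hbC, h.refl _⟩
      · exact ⟨h1, h.trans _ _ _ h2 hab⟩
  unfold KOdd
  rw [hfe, Finset.card_insert_of_notMem (by simp [hba])]
  rw [Nat.odd_add_one]; exact fun hh => hh hodd

theorem KPO.kodd_mono (h : KPO S r z u) {C D : Finset α} (hC : C ∈ KalCarrier S r)
    (hD : D ∈ KalCarrier S r) (hle : KalLER r C D) {x : α} (hx : KOdd r C x) :
    KOdd r D x := by
  obtain ⟨a, b, hp, hax, hbx⟩ := h.exists_pair hC hx
  obtain ⟨c, d, hq, hca, hbd⟩ := hle a b hp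
  exact h.kodd_of_pair hD hq (h.trans _ _ _ hca hax) (fun hdx => hbx (h.trans _ _ _ hbd hdx))

theorem KPO.le_of_kodd (h : KPO S r z u) {C D : Finset α} (hC : C ∈ KalCarrier S r)
    (hD : D ∈ KalCarrier S r) (hcmp : ∀ a ∈ C, ∀ b ∈ D, r a b ∨ r b a)
    (hx : ∀ x ∈ S, (x ∈ C ∨ x ∈ D) → KOdd r C x → KOdd r D x) : KalLER r C D := by
  intro a b hp
  have hp' := hp
  obtain ⟨haC, hbC, hab, hne, hodd, hsucc⟩ := hp'
  obtain ⟨c, d, hq, hca, hda⟩ := h.exists_pair hD (hx a (hC.1 haC) (Or.inl haC) hodd)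
  refine ⟨c, d, hq, hca, ?_⟩
  have hdD := hq.2.1
  by_contra hbd
  have had := (hcmp a haC d hdD).resolve_right hda
  exact h.kodd_pair_right hD hq
    (hx d (hD.1 hdD) (Or.inr hdD) (h.kodd_of_pair hC hp had hbd))

theorem KPO.mem_pair (h : KPO S r z u) {C : Finset α} (hC : C ∈ KalCarrier S r)
    {x : α} (hx : x ∈ C) : ∃ a b, KalPairR r C a b ∧ r a x ∧ r x b := by
  by_cases hodd : KOdd r C x
  · obtain ⟨a, b, hp, hax, hbx⟩ := h.exists_pair hC hodd
    exact ⟨a, b, hp, hax, (hC.2.1 x hx b hp.2.1).resolve_right hbx⟩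
  · have hfe : (C.filter fun y => r y x) = insert x (C.filter fun y => r y x ∧ y ≠ x) := by
      ext y; simp only [Finset.mem_filter, Finset.mem_insert]
      constructor
      · rintro ⟨h1, h2⟩; by_cases hy : y = x
        · exact Or.inl hy
        · exact Or.inr ⟨h1, h2, hy⟩
      · rintro (rfl | ⟨h1, h2, _⟩)
        · exact ⟨hx, h.refl _⟩
        · exact ⟨h1, h2⟩
    have ho : Odd (C.filter fun y => r y x ∧ y ≠ x).card := by
      unfold KOdd at hodd
      rw [hfe, Finset.card_insert_of_notMem (by simp), Nat.odd_add_one, not_not] at hodd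
      exact hodd
    obtain ⟨a, ha, hmax⟩ := kal_exists_max r h.refl h.trans _ (Finset.card_pos.1 ho.pos)
      (fun p hp q hq => hC.2.1 p (Finset.mem_filter.1 hp).1 q (Finset.mem_filter.1 hq).1)
    obtain ⟨haC, hax, hane⟩ := Finset.mem_filter.1 ha
    have hxa : ¬ r x a := fun hxa => hane (h.anti _ (hC.1 haC) _ (hC.1 hx) hax hxa)
    refine ⟨a, x, ⟨haC, hx, hax, hane, ?_, ?_⟩, hax, h.refl _⟩
    · convert ho using 2
      ext y; simp only [Finset.mem_filter]
      constructor
      · rintro ⟨h1, h2⟩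
        exact ⟨h1, h.trans _ _ _ h2 hax, by rintro rfl; exact hxa h2⟩
      · rintro ⟨h1, h2⟩; exact ⟨h1, hmax y (Finset.mem_filter.2 ⟨h1, h2⟩)⟩
    · intro c hc hac hca
      by_contra hxc
      have hcx := (hC.2.1 x hx c hc).resolve_left hxc
      have : r c a := hmax c (Finset.mem_filter.2 ⟨hc, hcx, by rintro rfl; exact hxc (h.refl _)⟩)
      exact hca (h.anti _ (hC.1 hc) _ (hC.1 haC) this hac)

theorem KPO.cmp_of_le (h : KPO S r z u) {C D : Finset α} (hC : C ∈ KalCarrier S r)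
    (hD : D ∈ KalCarrier S r) (hle : KalLER r C D) :
    ∀ a ∈ C, ∀ b ∈ D, r a b ∨ r b a := by
  intro x hx y hy
  obtain ⟨a, b, hp, hax, hxb⟩ := h.mem_pair hC hx
  obtain ⟨c, d, hq, hca, hbd⟩ := hle a b hp
  by_cases hyc : r y c
  · exact Or.inr (h.trans _ _ _ hyc (h.trans _ _ _ hca hax))
  · left
    have hcy := (hD.2.1 c hq.1 y hy).resolve_right hyc
    have := hq.2.2.2.2.2 y hy hcy (by rintro rfl; exact hyc (h.refl _))
    exact h.trans _ _ _ hxb (h.trans _ _ _ hbd this)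

theorem KPO.symmDiff_mem (_h : KPO S r z u) {A B : Finset α} (hA : A ∈ KalCarrier S r)
    (hB : B ∈ KalCarrier S r) (hcmp : ∀ a ∈ A, ∀ b ∈ B, r a b ∨ r b a) :
    symmDiff A B ∈ KalCarrier S r := by
  have hs : ∀ x ∈ symmDiff A B, x ∈ A ∨ x ∈ B := by
    intro x hx; rw [Finset.mem_symmDiff] at hx; tauto
  refine ⟨?_, ?_, ?_⟩
  · intro x hx
    rcases hs x (Finset.mem_coe.1 hx) with h1 | h1
    · exact hA.1 h1
    · exact hB.1 h1
  · intro x hx y hy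
    rcases hs x hx with h1 | h1 <;> rcases hs y hy with h2 | h2
    · exact hA.2.1 x h1 y h2
    · exact hcmp x h1 y h2
    · exact (hcmp y h2 x h1).symm
    · exact hB.2.1 x h1 y h2
  · rw [← Nat.not_odd_iff_even, kal_odd_symmDiff, not_not]
    simp [Nat.not_odd_iff_even.2 hA.2.2, Nat.not_odd_iff_even.2 hB.2.2]

theorem KPO.pair_mem (_h : KPO S r z u) {a b : α} (ha : a ∈ S) (hb : b ∈ S) (hab : r a b)
    (hne : a ≠ b) : ({a, b} : Finset α) ∈ KalCarrier S r := by
  refine ⟨?_, ?_, ?_⟩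
  · intro x hx
    simp at hx
    rcases hx with rfl | rfl <;> assumption
  · intro x hx y hy
    simp at hx hy
    rcases hx with rfl | rfl <;> rcases hy with rfl | rfl <;>
      first | exact Or.inl (_h.refl _) | exact Or.inl hab | exact Or.inr hab
  · rw [Finset.card_pair hne]; exact even_two

theorem KPO.kodd_pair (h : KPO S r z u) {a b x : α} (hab : r a b)
    (hne : a ≠ b) : KOdd r ({a, b} : Finset α) x ↔ r a x ∧ ¬ r b x := by
  unfold KOdd
  by_cases h1 : r b x
  · have h2 := h.trans _ _ _ hab h1
    rw [Finset.filter_true_of_mem (by simp [h1, h2]), Finset.card_pair hne]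
    simp [h1]
  · by_cases h2 : r a x
    · simp [Finset.filter_insert, Finset.filter_singleton, h1, h2]
    · simp [Finset.filter_insert, Finset.filter_singleton, h1, h2]

theorem KPO.compl_mem (h : KPO S r z u) {B : Finset α} (hB : B ∈ KalCarrier S r) :
    kalComplF z u B ∈ KalCarrier S r := by
  refine h.symmDiff_mem hB (h.pair_mem h.zmem h.umem (h.bot _ h.umem) h.ne) ?_
  intro a ha b hb
  simp at hb
  rcases hb with rfl | rfl
  · exact Or.inr (h.bot _ (hB.1 ha))
  · exact Or.inl (h.top _ (hB.1 ha))

theorem KPO.kodd_compl (h : KPO S r z u) {B : Finset α} {x : α} (hx : x ∈ S) (hxu : x ≠ u) :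
    KOdd r (kalComplF z u B) x ↔ ¬ KOdd r B x := by
  unfold kalComplF
  rw [KOdd_symmDiff, h.kodd_pair (h.bot _ h.umem) h.ne]
  have h1 := h.bot x hx
  have h2 : ¬ r u x := fun hh => hxu (h.anti _ hx _ h.umem (h.top _ hx) hh)
  tauto

theorem KPO.orth_of (h : KPO S r z u) {A B : Finset α} (hA : A ∈ KalCarrier S r)
    (hB : B ∈ KalCarrier S r) (hcmp : ∀ a ∈ A, ∀ b ∈ B, r a b ∨ r b a)
    (hd : ∀ x ∈ S, KOdd r A x → ¬ KOdd r B x) : KalLER r A (kalComplF z u B) := by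
  refine h.le_of_kodd hA (h.compl_mem hB) ?_ ?_
  · intro a ha b hb
    have : b ∈ B ∨ b = z ∨ b = u := by
      simp [kalComplF, Finset.mem_symmDiff] at hb; tauto
    rcases this with h1 | rfl | rfl
    · exact hcmp a ha b h1
    · exact Or.inr (h.bot _ (hA.1 ha))
    · exact Or.inl (h.top _ (hA.1 ha))
  · intro x hx _ hxA
    have hxu : x ≠ u := by rintro rfl; exact h.kodd_top hA hxA
    exact (h.kodd_compl hx hxu).2 (hd x hx hxA)

theorem KPO.orth_cmp (h : KPO S r z u) {A B : Finset α} (hA : A ∈ KalCarrier S r)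
    (hB : B ∈ KalCarrier S r) (ho : KalLER r A (kalComplF z u B)) :
    ∀ a ∈ A, ∀ b ∈ B, r a b ∨ r b a := by
  intro a ha b hb
  by_cases h1 : b = z
  · subst h1; exact Or.inr (h.bot _ (hA.1 ha))
  by_cases h2 : b = u
  · subst h2; exact Or.inl (h.top _ (hA.1 ha))
  refine h.cmp_of_le hA (h.compl_mem hB) ho a ha b ?_
  simp [kalComplF, Finset.mem_symmDiff, h1, h2, hb]

theorem KPO.lub (h : KPO S r z u) {A B : Finset α} (hA : A ∈ KalCarrier S r)
    (hB : B ∈ KalCarrier S r) (ho : KalLER r A (kalComplF z u B)) :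
    RelLUB (KalCarrier S r) (KalLER r) A B (symmDiff A B) := by
  have hcmp := h.orth_cmp hA hB ho
  have hd : ∀ x ∈ S, KOdd r A x → ¬ KOdd r B x := by
    intro x hx hxA
    have hxu : x ≠ u := by rintro rfl; exact h.kodd_top hA hxA
    exact (h.kodd_compl hx hxu).1 (h.kodd_mono hA (h.compl_mem hB) ho hxA)
  have hs : ∀ x ∈ symmDiff A B, x ∈ A ∨ x ∈ B := by
    intro x hx; rw [Finset.mem_symmDiff] at hx; tauto
  have hm := h.symmDiff_mem hA hB hcmp
  refine ⟨hm, ?_, ?_, ?_⟩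
  · refine h.le_of_kodd hA hm ?_ ?_
    · intro a ha b hb
      rcases hs b hb with h1 | h1
      · exact hA.2.1 a ha b h1
      · exact hcmp a ha b h1
    · intro x hx _ h1
      have := hd x hx h1
      rw [KOdd_symmDiff]; tauto
  · refine h.le_of_kodd hB hm ?_ ?_
    · intro a ha b hb
      rcases hs b hb with h1 | h1
      · exact (hcmp b h1 a ha).symm
      · exact hB.2.1 a ha b h1
    · intro x hx _ h1
      have := hd x hx
      rw [KOdd_symmDiff]; tauto
  · intro W hW hAW hBW
    refine h.le_of_kodd hm hW ?_ ?_
    · intro a ha b hb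
      rcases hs a ha with h1 | h1
      · exact h.cmp_of_le hA hW hAW a h1 b hb
      · exact h.cmp_of_le hB hW hBW a h1 b hb
    · intro x hx _ h1
      rw [KOdd_symmDiff] at h1
      by_cases h2 : KOdd r A x
      · exact h.kodd_mono hA hW hAW h2
      · exact h.kodd_mono hB hW hBW (by tauto)

theorem KPO.le_antisymm (h : KPO S r z u) {A B : Finset α} (hA : A ∈ KalCarrier S r)
    (hB : B ∈ KalCarrier S r) (h1 : KalLER r A B) (h2 : KalLER r B A) : A = B := by
  have hm := h.symmDiff_mem hA hB (h.cmp_of_le hA hB h1)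
  by_contra hne
  have hn : (symmDiff A B).Nonempty := by
    rw [Finset.nonempty_iff_ne_empty]
    intro he
    exact hne (symmDiff_eq_bot.1 he)
  obtain ⟨m, hmm, hmin⟩ := kal_exists_min r h.refl h.trans _ hn hm.2.1
  have hodd : KOdd r (symmDiff A B) m := by
    unfold KOdd
    have : (symmDiff A B).filter (fun y => r y m) = {m} := by
      ext y; simp only [Finset.mem_filter, Finset.mem_singleton]
      constructor
      · rintro ⟨h3, h4⟩
        exact h.anti _ (hm.1 h3) _ (hm.1 hmm) h4 (hmin y h3)
      · rintro rfl; exact ⟨hmm, h.refl _⟩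
    rw [this]; simp
  rw [KOdd_symmDiff] at hodd
  exact hodd ⟨h.kodd_mono hA hB h1, h.kodd_mono hB hA h2⟩

theorem KPO.empty_mem (_h : KPO S r z u) : (∅ : Finset α) ∈ KalCarrier S r :=
  ⟨by simp, by simp, by simp⟩

theorem KPO.lift (h : KPO S r z u) :
    KPO (KalCarrier S r) (KalLER r) (∅ : Finset α) ({z, u} : Finset α) where
  refl := fun C a b hp => ⟨a, b, hp, h.refl _, h.refl _⟩
  trans := by
    intro A B C h1 h2 a b hp
    obtain ⟨c, d, hq, h3, h4⟩ := h1 a b hp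
    obtain ⟨c', d', hq', h5, h6⟩ := h2 c d hq
    exact ⟨c', d', hq', h.trans _ _ _ h5 h3, h.trans _ _ _ h4 h6⟩
  anti := fun A hA B hB h1 h2 => h.le_antisymm hA hB h1 h2
  zmem := h.empty_mem
  umem := h.pair_mem h.zmem h.umem (h.bot _ h.umem) h.ne
  bot := by
    intro C _ a b hp
    exact absurd hp.1 (by simp)
  top := by
    intro C hC
    have hzu := h.bot _ h.umem
    refine h.le_of_kodd hC (h.pair_mem h.zmem h.umem hzu h.ne) ?_ ?_
    · intro a ha b hb
      simp at hb
      rcases hb with rfl | rfl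
      · exact Or.inr (h.bot _ (hC.1 ha))
      · exact Or.inl (h.top _ (hC.1 ha))
    · intro x hx _ hxC
      rw [h.kodd_pair hzu h.ne]
      refine ⟨h.bot _ hx, fun hux => ?_⟩
      have := h.anti _ hx _ h.umem (h.top _ hx) hux
      subst this
      exact h.kodd_top hC hxC
  ne := by
    intro he
    have : z ∈ (∅ : Finset α) := by rw [he]; simp
    simp at this

theorem KPO.lub_unique (h : KPO S r z u) {A B X Y : Finset α}
    (hX : RelLUB (KalCarrier S r) (KalLER r) A B X)
    (hY : RelLUB (KalCarrier S r) (KalLER r) A B Y) : X = Y :=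
  h.le_antisymm hX.1 hY.1 (hX.2.2.2 Y hY.1 hY.2.1 hY.2.2.1) (hY.2.2.2 X hX.1 hX.2.1 hX.2.2.1)

end

theorem mem_kalMuF {α : Type u} (𝒞 : Finset (Finset α)) (x : α) :
    x ∈ kalMuF 𝒞 ↔ Odd (𝒞.filter fun C => x ∈ C).card := by
  have h0 : x ∈ kalMuF 𝒞 ↔ x ∈ 𝒞.sup id ∧ Odd (𝒞.filter fun C => x ∈ C).card := by
    unfold kalMuF
    rw [Finset.mem_filter]
    refine and_congr ?_ ?_
    · simp [Finset.mem_sup]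
    · have : ∀ (i j : DecidablePred fun C : Finset α => x ∈ C),
          Odd (@Finset.filter _ _ i 𝒞).card ↔ Odd (@Finset.filter _ _ j 𝒞).card := by
        intro i j
        rw [Subsingleton.elim i j]
      exact this _ _
  rw [h0]
  refine ⟨fun h => h.2, fun h => ⟨?_, h⟩⟩
  obtain ⟨C, hC⟩ := Finset.card_pos.1 h.pos
  obtain ⟨h1, h2⟩ := Finset.mem_filter.1 hC
  rw [Finset.mem_sup]
  exact ⟨C, h1, h2⟩

theorem kalMuF_symmDiff {α : Type u} (A B : Finset (Finset α)) :
    kalMuF (symmDiff A B) = symmDiff (kalMuF A) (kalMuF B) := by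
  ext x
  rw [mem_kalMuF, kal_odd_filter_symmDiff, Finset.mem_symmDiff, mem_kalMuF, mem_kalMuF]
  tauto

theorem kalMuF_singleton {α : Type u} (A : Finset α) : kalMuF {A} = A := by
  ext x
  rw [mem_kalMuF, Finset.filter_singleton]
  by_cases h : x ∈ A <;> simp [h]

theorem kalMuF_pair {α : Type u} {A B : Finset α} (h : A ≠ B) :
    kalMuF {A, B} = symmDiff A B := by
  have : ({A, B} : Finset (Finset α)) = symmDiff {A} {B} := by
    ext x; simp only [Finset.mem_insert, Finset.mem_singleton, Finset.mem_symmDiff]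
    constructor
    · rintro (rfl | rfl)
      · exact Or.inl ⟨rfl, h⟩
      · exact Or.inr ⟨rfl, h.symm⟩
    · tauto
  rw [this, kalMuF_symmDiff, kalMuF_singleton, kalMuF_singleton]

theorem kal_main {P : Type u} {S : Set P} {r : P → P → Prop} {z u : P}
    (h : KPO S r z u) (e : Finset (Finset P) → Finset P)
    (hmem : ∀ x ∈ KalCarrier (KalCarrier S r) (KalLER r), e x ∈ KalCarrier S r)
    (horth : ∀ a ∈ KalCarrier (KalCarrier S r) (KalLER r),
      ∀ b ∈ KalCarrier (KalCarrier S r) (KalLER r),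
      KalLER (KalLER r) a (kalComplF ∅ {z, u} b) → KalLER r (e a) (kalComplF z u (e b)))
    (hsup : ∀ a ∈ KalCarrier (KalCarrier S r) (KalLER r),
      ∀ b ∈ KalCarrier (KalCarrier S r) (KalLER r),
      KalLER (KalLER r) a (kalComplF ∅ {z, u} b) → ∀ j,
      RelLUB (KalCarrier (KalCarrier S r) (KalLER r)) (KalLER (KalLER r)) a b j →
      RelLUB (KalCarrier S r) (KalLER r) (e a) (e b) (e j))
    (hunit : ∀ C ∈ KalCarrier S r, e (kalEtaF (∅ : Finset P) C) = C) :
    ∀ 𝒞 ∈ KalCarrier (KalCarrier S r) (KalLER r), e 𝒞 = kalMuF 𝒞 := by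
  have hK := h.lift
  have hadd : ∀ a ∈ KalCarrier (KalCarrier S r) (KalLER r),
      ∀ b ∈ KalCarrier (KalCarrier S r) (KalLER r),
      (∀ x ∈ a, ∀ y ∈ b, KalLER r x y ∨ KalLER r y x) →
      (∀ x ∈ KalCarrier S r, KOdd (KalLER r) a x → ¬ KOdd (KalLER r) b x) →
      e (symmDiff a b) = symmDiff (e a) (e b) := by
    intro a ha b hb hcmp hd
    have ho := hK.orth_of ha hb hcmp hd
    exact h.lub_unique (hsup a ha b hb ho _ (hK.lub ha hb ho))
      (h.lub (hmem a ha) (hmem b hb) (horth a ha b hb ho))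
  have hpair : ∀ C ∈ KalCarrier S r, ∀ D ∈ KalCarrier S r, KalLER r C D → C ≠ D →
      e {C, D} = symmDiff C D := by
    intro C hC D hD hCD hne
    by_cases hC0 : C = ∅
    · subst hC0
      have := hunit D hD
      rw [kalEtaF, if_neg hne.symm] at this
      rw [this]
      exact (bot_symmDiff D).symm
    · have hD0 : D ≠ ∅ := by
        rintro rfl
        exact hC0 (hK.anti _ hC _ hD hCD (hK.bot _ hC))
      have h0C := hK.bot _ hC
      have h0D := hK.bot _ hD
      have h1 := hadd {∅, C} (hK.pair_mem hK.zmem hC h0C (Ne.symm hC0)) {C, D}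
        (hK.pair_mem hC hD hCD hne) (by
          intro x hx y hy
          simp only [Finset.mem_insert, Finset.mem_singleton] at hx hy
          rcases hx with rfl | rfl <;> rcases hy with rfl | rfl
          · exact Or.inl h0C
          · exact Or.inl h0D
          · exact Or.inl (hK.refl _)
          · exact Or.inl hCD) (by
          intro x hx
          rw [hK.kodd_pair h0C (Ne.symm hC0), hK.kodd_pair hCD hne]
          tauto)
      have h2 : symmDiff ({∅, C} : Finset (Finset P)) {C, D} = {∅, D} := by
        ext x; simp only [Finset.mem_insert, Finset.mem_singleton, Finset.mem_symmDiff]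
        constructor
        · tauto
        · rintro (rfl | rfl)
          · left; exact ⟨Or.inl rfl, by rintro (h | h); exacts [hC0 h.symm, hD0 h.symm]⟩
          · right; exact ⟨Or.inr rfl, by rintro (h | h); exacts [hD0 h, hne h.symm]⟩
      rw [h2] at h1
      have h3 := hunit D hD
      rw [kalEtaF, if_neg hD0] at h3
      have h4 := hunit C hC
      rw [kalEtaF, if_neg hC0] at h4
      rw [h3, h4] at h1
      conv_rhs => rw [h1, symmDiff_symmDiff_cancel_left]
  have key : ∀ n : ℕ, ∀ 𝒞 ∈ KalCarrier (KalCarrier S r) (KalLER r), 𝒞.card = n →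
      e 𝒞 = kalMuF 𝒞 := by
    intro n
    induction n using Nat.strong_induction_on with
    | _ n ih =>
    intro 𝒞 h𝒞 hn
    by_cases hem : 𝒞 = ∅
    · subst hem
      have := hunit ∅ hK.zmem
      rw [kalEtaF, if_pos rfl] at this
      rw [this]
      ext x; simp [mem_kalMuF]
    have hne : 𝒞.Nonempty := Finset.nonempty_iff_ne_empty.2 hem
    obtain ⟨D, hD, hDmax⟩ := kal_exists_max _ hK.refl hK.trans 𝒞 hne h𝒞.2.1
    have hce := Finset.card_erase_of_mem hD
    have hpos := Finset.card_pos.2 hne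
    have hev := h𝒞.2.2
    have hne2 : (𝒞.erase D).Nonempty := by
      rw [← Finset.card_pos, hce]
      obtain ⟨k, hk⟩ := hev
      omega
    obtain ⟨C, hC', hCmax⟩ := kal_exists_max _ hK.refl hK.trans (𝒞.erase D) hne2
      (fun x hx y hy => h𝒞.2.1 x (Finset.mem_of_mem_erase hx) y (Finset.mem_of_mem_erase hy))
    have hCD : C ≠ D := Finset.ne_of_mem_erase hC'
    have hC : C ∈ 𝒞 := Finset.mem_of_mem_erase hC'
    have hce2 := Finset.card_erase_of_mem hC'
    have hle := hDmax C hC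
    have hpm := hK.pair_mem (h𝒞.1 hC) (h𝒞.1 hD) hle hCD
    have hsub : ∀ x ∈ (𝒞.erase D).erase C, x ∈ 𝒞 := fun x hx =>
      Finset.mem_of_mem_erase (Finset.mem_of_mem_erase hx)
    have heven : Even ((𝒞.erase D).erase C).card := by
      rw [hce2, hce]
      obtain ⟨k, hk⟩ := hev
      exact ⟨k - 1, by omega⟩
    have hm' : (𝒞.erase D).erase C ∈ KalCarrier (KalCarrier S r) (KalLER r) :=
      ⟨fun x hx => h𝒞.1 (hsub x hx),
        fun x hx y hy => h𝒞.2.1 x (hsub x hx) y (hsub y hy), heven⟩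
    have hsd : 𝒞 = symmDiff ((𝒞.erase D).erase C) {C, D} := by
      ext x; simp only [Finset.mem_insert, Finset.mem_singleton, Finset.mem_symmDiff,
        Finset.mem_erase]
      by_cases h1 : x = C
      · subst h1; simp [hC]
      · by_cases h2 : x = D
        · subst h2; simp [hD]
        · simp [h1, h2]
    have h1 := hadd _ hm' _ hpm (by
      intro x hx y hy
      refine h𝒞.2.1 x (hsub x hx) y ?_
      simp only [Finset.mem_insert, Finset.mem_singleton] at hy
      rcases hy with rfl | rfl <;> assumption) (by
      intro x hx ho hp
      rw [hK.kodd_pair hle hCD] at hp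
      unfold KOdd at ho
      rw [Finset.filter_true_of_mem] at ho
      · exact Nat.not_odd_iff_even.2 heven ho
      · intro y hy
        exact hK.trans _ _ _ (hCmax y (Finset.mem_of_mem_erase hy)) hp.1)
    rw [← hsd] at h1
    have h2 := ih ((𝒞.erase D).erase C).card (by
      rw [hce2, hce, ← hn]; omega) _ hm' rfl
    rw [h1, h2, hpair C (h𝒞.1 hC) D (h𝒞.1 hD) hle hCD]
    conv_rhs => rw [hsd, kalMuF_symmDiff, kalMuF_pair hCD]
  exact fun 𝒞 h𝒞 => key _ 𝒞 h𝒞 rfl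

end

/-- The multiplication `μ = U ε K` of the Kalmbach monad is given
explicitly by symmetric difference: the counit `ε` at `K(P)` — i.e. the (unique)
OMP-morphism `e : K(K(P)) → K(P)` with `e ∘ η_{K(P)} = id` — satisfies
`e [C₁ < C₂ < … < C_{2n}] = C₁ Δ C₂ Δ … Δ C_{2n}` for every even chain of even
chains. -/
theorem kalmbach_monad_multiplication_is_symmDiff
    (P : Type u) [PartialOrder P] [BoundedOrder P] [Nontrivial P]
    (e : Finset (Finset P) → Finset P)
    (he : RelOMPHom
      (KalCarrier (KalCarrier Set.univ ((· ≤ ·) : P → P → Prop))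
        (KalLER ((· ≤ ·) : P → P → Prop)))
      (KalLER (KalLER ((· ≤ ·) : P → P → Prop)))
      (kalComplF (∅ : Finset P) ({⊥, ⊤} : Finset P))
      ({∅, ({⊥, ⊤} : Finset P)} : Finset (Finset P))
      (KalCarrier Set.univ ((· ≤ ·) : P → P → Prop))
      (KalLER ((· ≤ ·) : P → P → Prop))
      (kalComplF (⊥ : P) ⊤)
      ({⊥, ⊤} : Finset P)
      e)
    (hunit : ∀ C ∈ KalCarrier Set.univ ((· ≤ ·) : P → P → Prop),
      e (kalEtaF (∅ : Finset P) C) = C) :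
    ∀ 𝒞 ∈ KalCarrier (KalCarrier Set.univ ((· ≤ ·) : P → P → Prop))
        (KalLER ((· ≤ ·) : P → P → Prop)),
      e 𝒞 = kalMuF 𝒞 := by
  have h : KPO (Set.univ : Set P) ((· ≤ ·) : P → P → Prop) ⊥ ⊤ :=
    { refl := fun a => le_refl a
      trans := fun a b c h1 h2 => le_trans h1 h2
      anti := fun a _ b _ h1 h2 => le_antisymm h1 h2
      zmem := Set.mem_univ _
      umem := Set.mem_univ _
      bot := fun a _ => bot_le
      top := fun a _ => le_top
      ne := bot_ne_top }
  refine kal_main h e he.mem ?_ ?_ hunit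
  · intro a ha b hb hab
    exact he.map_orth a ha b hb (by convert hab)
  · intro a ha b hb hab j hj
    exact he.map_sup a ha b hb (by convert hab) j hj
end

section
/- The category of effect algebras is isomorphic to the Eilenberg-Moore category of algebras for the Kalmbach monad on the category of bounded posets. -/
attribute [local instance] Classical.propDecidable

universe u v w

/-- An effect algebra: a partial algebra `(E, ⊕, 0, 1)`, encoded by the domain
predicate `D` of the partial operation `⊕` together with a total function `add`
(whose values outside `D` are irrelevant), satisfying axioms (E1)-(E4). -/
structure EffectAlgebra (E : Type u) : Type u where
  /-- `D a b` means that `a ⊕ b` is defined. -/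
  D : E → E → Prop
  /-- the partial sum `a ⊕ b` -/
  add : E → E → E
  zero : E
  one : E
  /-- (E1) -/
  D_comm : ∀ {a b}, D a b → D b a
  /-- (E1) -/
  add_comm : ∀ {a b}, D a b → add a b = add b a
  /-- (E2) -/
  D_of_assoc : ∀ {a b c}, D a b → D (add a b) c → D b c
  /-- (E2) -/
  D_assoc : ∀ {a b c}, D a b → D (add a b) c → D a (add b c)
  /-- (E2) -/
  add_assoc : ∀ {a b c}, D a b → D (add a b) c → add (add a b) c = add a (add b c)
  /-- (E3) -/
  orthosupplement : ∀ a, ∃! x, D a x ∧ add a x = one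
  /-- (E4) -/
  D_one : ∀ {a}, D a one → a = zero

namespace EffectAlgebra

/-- The induced order of an effect algebra: `a ≤ b` iff `∃ c, a ⊕ c = b`. -/
def le {E : Type u} (A : EffectAlgebra E) (a b : E) : Prop :=
  ∃ c, A.D a c ∧ A.add a c = b

/-- The orthosupplement `a'`: the unique element with `a ⊕ a' = 1`. -/
noncomputable def orth {E : Type u} (A : EffectAlgebra E) (a : E) : E :=
  (A.orthosupplement a).exists.choose

/-- The partial difference: for `a ≤ b`, `sub b a` is the unique `c` with `a ⊕ c = b`
(and a junk value `0` otherwise). -/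
noncomputable def sub {E : Type u} (A : EffectAlgebra E) (b a : E) : E :=
  if h : ∃ c, A.D a c ∧ A.add a c = b then h.choose else A.zero

/-- A morphism of effect algebras: `f 1 = 1`, and whenever `a ⊕ b` is defined,
`f a ⊕ f b` is defined and equals `f (a ⊕ b)`. -/
def Hom {E : Type u} {F : Type v} (A : EffectAlgebra E) (B : EffectAlgebra F)
    (f : E → F) : Prop :=
  f A.one = B.one ∧ ∀ a b, A.D a b → B.D (f a) (f b) ∧ f (A.add a b) = B.add (f a) (f b)

end EffectAlgebra

/-- `eaSumList A [x₁, x₂, …, x_{2n}] = (x₂ ⊖ x₁) ⊕ (x₄ ⊖ x₃) ⊕ … ⊕ (x_{2n} ⊖ x_{2n-1})`. -/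
noncomputable def eaSumList {E : Type u} (A : EffectAlgebra E) : List E → E
  | [] => A.zero
  | [_] => A.zero
  | a :: b :: l => A.add (A.sub b a) (eaSumList A l)

/-- All differences and sums occurring in `eaSumList` are defined. -/
def eaSumListDefined {E : Type u} (A : EffectAlgebra E) : List E → Prop
  | [] => True
  | [_] => False
  | a :: b :: l => A.le a b ∧ A.D (A.sub b a) (eaSumList A l) ∧ eaSumListDefined A l

/-- The structure map `m_A : K(U(A)) → U(A)`,
`m_A [x₁<x₂<…<x_{2n}] = (x₂ ⊖ x₁) ⊕ … ⊕ (x_{2n} ⊖ x_{2n-1})`. -/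
noncomputable def eaM {E : Type u} (A : EffectAlgebra E) (C : Finset E) : E :=
  eaSumList A (chainSortR A.le C)

/-- An Eilenberg-Moore algebra for the Kalmbach monad: a bounded poset `P` together
with a bounded-poset morphism `m : T P → P` (monotone, preserving bottom `∅` and top
`{⊥,⊤}`) satisfying the unit law `m ∘ η = id` and the multiplication law
`m ∘ T m = m ∘ μ`. -/
def IsEMAlgebra (P : Type u) [PartialOrder P] [BoundedOrder P] (m : Finset P → P) : Prop :=
  (∀ C ∈ KalCarrier Set.univ ((· ≤ ·) : P → P → Prop),
     ∀ D ∈ KalCarrier Set.univ ((· ≤ ·) : P → P → Prop),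
       KalLER (· ≤ ·) C D → m C ≤ m D) ∧
  m ∅ = ⊥ ∧ m ({⊥, ⊤} : Finset P) = ⊤ ∧
  (∀ a : P, m (kalEtaF ⊥ a) = a) ∧
  (∀ 𝒞 : Finset (Finset P),
     𝒞 ∈ KalCarrier (KalCarrier Set.univ ((· ≤ ·) : P → P → Prop))
           (KalLER ((· ≤ ·) : P → P → Prop)) →
       m (kalMapF m 𝒞) = m (kalMuF 𝒞))

/-- The effect algebra `A` lives on the bounded poset `P`: its constants are `⊥`, `⊤`
and its induced order is the order of `P`. -/
def CompatEA (P : Type u) [PartialOrder P] [BoundedOrder P] (A : EffectAlgebra P) : Prop :=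
  A.zero = ⊥ ∧ A.one = ⊤ ∧ ∀ a b : P, A.le a b ↔ a ≤ b


set_option linter.unusedSectionVars false

namespace Kal

section general
variable {α : Type u} {β : Type v}

theorem exists_max (r : α → α → Prop) (hrefl : ∀ a, r a a) (htr : ∀ a b c, r a b → r b c → r a c)
    (C : Finset α) (hC : ∀ a ∈ C, ∀ b ∈ C, r a b ∨ r b a) (hne : C.Nonempty) :
    ∃ x ∈ C, ∀ y ∈ C, r y x := by
  induction hne using Finset.Nonempty.cons_induction with
  | singleton a => exact ⟨a, by simp, by simpa using hrefl a⟩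
  | cons a s ha hs ih =>
    obtain ⟨x, hx, hmax⟩ := ih (fun a ha b hb => hC a (by simp [ha]) b (by simp [hb]))
    rcases hC a (by simp) x (by simp [hx]) with h | h
    · refine ⟨x, by simp [hx], ?_⟩
      intro y hy
      rcases Finset.mem_cons.1 hy with rfl | hy
      · exact h
      · exact hmax y hy
    · refine ⟨a, by simp, ?_⟩
      intro y hy
      rcases Finset.mem_cons.1 hy with rfl | hy
      · exact hrefl _
      · exact htr _ _ _ (hmax y hy) h

theorem chain_ind (r : α → α → Prop) (hrefl : ∀ a, r a a) (htr : ∀ a b c, r a b → r b c → r a c)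
    (p : Finset α → Prop) (h0 : p ∅)
    (hs : ∀ x C, x ∉ C → (∀ y ∈ C, r y x) → (∀ a ∈ C, ∀ b ∈ C, r a b ∨ r b a) → p C →
      p (insert x C)) :
    ∀ C : Finset α, (∀ a ∈ C, ∀ b ∈ C, r a b ∨ r b a) → p C := by
  intro C
  induction C using Finset.strongInduction with
  | H C ih =>
    intro hC
    rcases C.eq_empty_or_nonempty with rfl | hne
    · exact h0
    · obtain ⟨x, hx, hmax⟩ := exists_max r hrefl htr C hC hne
      have h1 : ∀ a ∈ C.erase x, ∀ b ∈ C.erase x, r a b ∨ r b a := fun a ha b hb =>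
        hC a (Finset.mem_of_mem_erase ha) b (Finset.mem_of_mem_erase hb)
      have := hs x (C.erase x) (by simp) (fun y hy => hmax y (Finset.mem_of_mem_erase hy)) h1
        (ih _ (Finset.erase_ssubset hx) h1)
      rwa [Finset.insert_erase hx] at this

theorem chain_ind' (r : α → α → Prop) (hrefl : ∀ a, r a a) (htr : ∀ a b c, r a b → r b c → r a c)
    (p : Finset α → Prop) (h0 : p ∅)
    (hs : ∀ x C C', x ∉ C → (∀ Y, Y ∈ C' ↔ Y = x ∨ Y ∈ C) → (∀ y ∈ C, r y x) → p C → p C') :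
    ∀ C : Finset α, (∀ a ∈ C, ∀ b ∈ C, r a b ∨ r b a) → p C :=
  chain_ind r hrefl htr p h0 fun x C hx h1 _ h3 =>
    hs x C _ hx (fun _ => Finset.mem_insert) h1 h3

theorem odd_symmDiff (C D : Finset α) (p : α → Prop) :
    Odd ((symmDiff C D).filter p).card ↔ ¬ (Odd (C.filter p).card ↔ Odd (D.filter p).card) := by
  have h1 : (symmDiff C D).filter p = symmDiff (C.filter p) (D.filter p) := by
    ext x; simp only [Finset.mem_filter, Finset.mem_symmDiff]; tauto
  rw [h1]
  generalize C.filter p = X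
  generalize D.filter p = Y
  have h2 : (symmDiff X Y).card = (X \ Y).card + (Y \ X).card := by
    rw [symmDiff_def, Finset.sup_eq_union, Finset.card_union_of_disjoint]
    exact disjoint_sdiff_sdiff
  have h3 := Finset.card_sdiff_add_card_inter X Y
  have h4 := Finset.card_sdiff_add_card_inter Y X
  rw [Finset.inter_comm] at h4
  simp only [Nat.odd_iff]
  omega

theorem odd_symmDiff_card (C D : Finset α) :
    Odd (symmDiff C D).card ↔ ¬ (Odd C.card ↔ Odd D.card) := by
  have := odd_symmDiff C D (fun _ => True)
  simpa using this

theorem odd_single (a : α) (p : α → Prop) : Odd (({a} : Finset α).filter p).card ↔ p a := by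
  rw [Finset.filter_singleton]; split_ifs with h <;> simp [h]

theorem symmDiff_single_insert (x : α) (C : Finset α) (h : x ∉ C) :
    symmDiff {x} C = insert x C := by
  ext y; simp only [Finset.mem_symmDiff, Finset.mem_singleton, Finset.mem_insert]
  by_cases hy : y = x
  · subst hy; simp [h]
  · simp [hy]

theorem mem_kalMapF (f : α → β) (C : Finset α) (y : β) :
    y ∈ kalMapF f C ↔ Odd (C.filter fun x => f x = y).card := by
  unfold kalMapF
  rw [Finset.mem_filter]
  constructor
  · exact fun h => h.2
  · intro h
    refine ⟨?_, h⟩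
    obtain ⟨x, hx⟩ := Finset.card_pos.1 h.pos
    rw [Finset.mem_filter] at hx
    exact Finset.mem_image.2 ⟨x, hx⟩

theorem mem_kalMuF (C : Finset (Finset α)) (y : α) :
    y ∈ kalMuF C ↔ Odd (C.filter fun X => y ∈ X).card := by
  unfold kalMuF
  rw [Finset.mem_filter]
  constructor
  · exact fun h => h.2
  · intro h
    refine ⟨?_, h⟩
    obtain ⟨x, hx⟩ := Finset.card_pos.1 h.pos
    rw [Finset.mem_filter] at hx
    exact Finset.mem_sup.2 ⟨x, hx⟩

theorem kalMapF_insert (f : α → β) (x : α) (C : Finset α) (h : x ∉ C) :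
    kalMapF f (insert x C) = symmDiff {f x} (kalMapF f C) := by
  ext y
  rw [mem_kalMapF, ← symmDiff_single_insert x C h, odd_symmDiff, odd_single, Finset.mem_symmDiff,
    mem_kalMapF, Finset.mem_singleton]
  by_cases hy : y = f x
  · subst hy; simp
  · have : ¬ f x = y := fun h => hy h.symm
    simp [hy, this]

theorem odd_insert_filter (x : α) (C C' : Finset α) (h : x ∉ C)
    (hC' : ∀ Y, Y ∈ C' ↔ Y = x ∨ Y ∈ C) (p : α → Prop) [DecidablePred p] :
    Odd (C'.filter p).card ↔ ¬ (p x ↔ Odd (C.filter p).card) := by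
  have e : C' = symmDiff {x} C := by
    rw [symmDiff_single_insert x C h]
    ext Y; rw [hC', Finset.mem_insert]
  have := odd_symmDiff {x} C p
  rw [odd_single, ← e] at this
  convert this

theorem kalMuF_insert (x : Finset α) (C C' : Finset (Finset α)) (h : x ∉ C)
    (hC' : ∀ Y, Y ∈ C' ↔ Y = x ∨ Y ∈ C) :
    kalMuF C' = symmDiff x (kalMuF C) := by
  ext y
  rw [mem_kalMuF, odd_insert_filter x C C' h hC', Finset.mem_symmDiff, mem_kalMuF]
  tauto

theorem kalMapF_insert' (f : α → β) (x : α) (C C' : Finset α) (h : x ∉ C)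
    (hC' : ∀ Y, Y ∈ C' ↔ Y = x ∨ Y ∈ C) :
    kalMapF f C' = symmDiff {f x} (kalMapF f C) := by
  rw [← kalMapF_insert f x C h]
  congr 1
  ext Y; rw [hC', Finset.mem_insert]

theorem symmDiff_emp (x : α) : symmDiff {x} (∅ : Finset α) = {x} := by
  rw [symmDiff_single_insert _ _ (by simp)]; rfl

theorem kalMapF_empty (f : α → β) : kalMapF f ∅ = ∅ := by
  ext y; rw [mem_kalMapF]; simp

theorem kalMuF_empty : kalMuF (∅ : Finset (Finset α)) = ∅ := by
  ext y; rw [mem_kalMuF]; simp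

theorem kalMapF_odd (f : α → β) (C : Finset α) : Odd (kalMapF f C).card ↔ Odd C.card := by
  induction C using Finset.induction_on with
  | empty => rw [kalMapF_empty]; simp
  | insert x s h ih =>
    rw [kalMapF_insert f x s h, odd_symmDiff_card, ih, ← symmDiff_single_insert x s h,
      odd_symmDiff_card]
    simp

theorem kalMapF_sub (f : α → β) (C : Finset α) (y : β) (hy : y ∈ kalMapF f C) :
    ∃ x ∈ C, f x = y := by
  unfold kalMapF at hy
  rw [Finset.mem_filter] at hy
  exact Finset.mem_image.1 hy.1

end general

section order
variable {P : Type u} [PartialOrder P]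

/-- chain -/
def Ch (C : Finset P) : Prop := ∀ a ∈ C, ∀ b ∈ C, a ≤ b ∨ b ≤ a

theorem Ch.mono {C D : Finset P} (h : Ch D) (hs : C ⊆ D) : Ch C :=
  fun a ha b hb => h a (hs ha) b (hs hb)

theorem Ch.ind (p : Finset P → Prop) (h0 : p ∅)
    (hs : ∀ x C, (∀ y ∈ C, y < x) → Ch C → p C → p (insert x C)) :
    ∀ C : Finset P, Ch C → p C := by
  apply chain_ind (· ≤ ·) le_refl (fun _ _ _ => le_trans) p h0
  intro x C hx hle hC hp
  exact hs x C (fun y hy => lt_of_le_of_ne (hle y hy) (fun h => hx (h ▸ hy))) hC hp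

theorem Ch.min {C : Finset P} (h : Ch C) (hne : C.Nonempty) : ∃ x ∈ C, ∀ y ∈ C, x ≤ y :=
  exists_max (fun a b : P => b ≤ a) le_refl (fun _ _ _ h1 h2 => le_trans h2 h1) C
    (fun a ha b hb => (h a ha b hb).symm) hne

theorem Ch.max {C : Finset P} (h : Ch C) (hne : C.Nonempty) : ∃ x ∈ C, ∀ y ∈ C, y ≤ x :=
  exists_max (fun a b : P => a ≤ b) le_refl (fun _ _ _ h1 h2 => le_trans h1 h2) C
    h hne

theorem chainSort_pairwise {C : Finset P} (h : Ch C) :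
    (chainSortR (· ≤ ·) C).Pairwise (· ≤ ·) := by
  obtain ⟨s, hs, hrs⟩ := extend_partialOrder ((· ≤ ·) : P → P → Prop)
  have key : chainSortR (· ≤ ·) C = chainSortR s C := by
    unfold chainSortR
    have := List.map_mergeSort (r := fun a b : P => decide (a ≤ b)) (s := fun a b => decide (s a b))
      (f := id) (l := C.toList) (by
        intro a ha b hb
        rw [Finset.mem_toList] at ha hb
        simp only [id, decide_eq_decide]
        refine ⟨hrs a b, fun hab => ?_⟩
        rcases h a ha b hb with h1 | h1
        · exact h1
        · exact (hs.antisymm _ _ hab (hrs _ _ h1)).le)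
    simpa using this
  have hp : (chainSortR s C).Pairwise (fun a b => s a b) := by
    unfold chainSortR
    have := List.pairwise_mergeSort (le := fun a b => decide (s a b)) 
      (by intro a b c; simpa using hs.trans a b c) (by intro a b; simpa using hs.total a b) C.toList
    simpa using this
  rw [key]
  refine hp.imp_of_mem ?_
  intro a b ha hb hab
  have ha' : a ∈ C := by simpa [chainSortR] using ha
  have hb' : b ∈ C := by simpa [chainSortR] using hb
  rcases h a ha' b hb' with h1 | h1
  · exact h1
  · exact (hs.antisymm _ _ hab (hrs _ _ h1)).le

theorem chainSort_perm (C : Finset P) : (chainSortR (· ≤ ·) C).Perm C.toList := by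
  unfold chainSortR; exact List.mergeSort_perm _ _

theorem chainSort_insert {C : Finset P} (h : Ch C) {x : P} (hx : ∀ y ∈ C, y < x) :
    chainSortR (· ≤ ·) (insert x C) = chainSortR (· ≤ ·) C ++ [x] := by
  have hC' : Ch (insert x C) := by
    intro a ha b hb
    rcases Finset.mem_insert.1 ha with rfl | ha
    · rcases Finset.mem_insert.1 hb with rfl | hb
      · simp
      · exact Or.inr (hx b hb).le
    · rcases Finset.mem_insert.1 hb with hb | hb
      · exact Or.inl (hb ▸ (hx a ha).le)
      · exact h a ha b hb
  have hxC : x ∉ C := fun hm => lt_irrefl _ (hx x hm)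
  have hm : ∀ a ∈ chainSortR (· ≤ ·) C, a ∈ C := by
    intro a ha; simpa [chainSortR] using ha
  have hp2 : (chainSortR (· ≤ ·) C ++ [x]).Pairwise (· ≤ ·) := by
    rw [List.pairwise_append]
    refine ⟨chainSort_pairwise h, by simp, ?_⟩
    intro a ha b hb
    rw [List.mem_singleton] at hb
    subst hb
    exact (hx a (hm a ha)).le
  have hperm : (chainSortR (· ≤ ·) (insert x C)).Perm (chainSortR (· ≤ ·) C ++ [x]) := by
    refine (chainSort_perm _).trans ?_
    refine (Finset.toList_insert hxC).trans ?_
    refine List.Perm.trans ?_ (List.perm_append_comm (l₁ := [x]))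
    exact List.Perm.cons _ (chainSort_perm C).symm
  exact hperm.eq_of_pairwise (fun a b _ _ h1 h2 => le_antisymm h1 h2) (chainSort_pairwise hC') hp2

end order
end Kal

namespace Kal
section kalorder
variable {P : Type u} [PartialOrder P]

/-- parity -/
def Od (C : Finset P) (x : P) : Prop := Odd (C.filter fun y => y ≤ x).card

theorem Od_symmDiff (C D : Finset P) (x : P) : Od (symmDiff C D) x ↔ ¬ (Od C x ↔ Od D x) :=
  odd_symmDiff C D _

theorem Od_single (a x : P) : Od {a} x ↔ a ≤ x := odd_single a _

/-- pointwise order on even chains -/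
def Le' (C D : Finset P) : Prop := Ch (C ∪ D) ∧ ∀ x ∈ C ∪ D, Od C x → Od D x

/-- even chain -/
def EC (C : Finset P) : Prop := Ch C ∧ Even C.card

theorem mem_car (C : Finset P) : C ∈ KalCarrier Set.univ ((· ≤ ·) : P → P → Prop) ↔ EC C := by
  unfold KalCarrier EC IsEvenChainR Ch
  simp

theorem exists_pair {D : Finset P} (hD : EC D) {x : P} (hx : Od D x) :
    ∃ c d, KalPairR (· ≤ ·) D c d ∧ c ≤ x ∧ ¬ d ≤ x ∧ (∀ y ∈ D, y ≤ x → y ≤ c) := by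
  have hne : (D.filter fun y => y ≤ x).Nonempty := Finset.card_pos.1 (Odd.pos hx)
  obtain ⟨c, hc, hmax⟩ := (hD.1.mono (Finset.filter_subset _ _)).max hne
  rw [Finset.mem_filter] at hc
  have hmax' : ∀ y ∈ D, y ≤ x → y ≤ c := fun y hy hyx => hmax y (Finset.mem_filter.2 ⟨hy, hyx⟩)
  have e : (D.filter fun y => y ≤ c) = D.filter fun y => y ≤ x := by
    ext y; simp only [Finset.mem_filter]
    exact ⟨fun h => ⟨h.1, h.2.trans hc.2⟩, fun h => ⟨h.1, hmax' y h.1 h.2⟩⟩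
  have hne2 : (D.filter fun y => ¬ y ≤ x).Nonempty := by
    by_contra hcon
    rw [Finset.not_nonempty_iff_eq_empty, Finset.filter_eq_empty_iff] at hcon
    have : (D.filter fun y => y ≤ x) = D := by
      rw [Finset.filter_eq_self]; intro y hy; simpa using hcon hy
    unfold Od at hx
    rw [this] at hx
    exact (Nat.not_even_iff_odd.2 hx) hD.2
  obtain ⟨d, hd, hmin⟩ := (hD.1.mono (Finset.filter_subset _ _)).min hne2
  rw [Finset.mem_filter] at hd
  refine ⟨c, d, ⟨hc.1, hd.1, ?_, ?_, ?_, ?_⟩, hc.2, hd.2, hmax'⟩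
  · rcases hD.1 c hc.1 d hd.1 with h | h
    · exact h
    · exact absurd (h.trans hc.2) hd.2
  · rintro rfl; exact hd.2 hc.2
  · rw [e]; exact hx
  · intro y hy hcy hne
    exact hmin y (Finset.mem_filter.2 ⟨hy, fun h => hne (le_antisymm (hmax' y hy h) hcy)⟩)

theorem mem_pair {C : Finset P} (hC : EC C) {a : P} (ha : a ∈ C) :
    ∃ p q, KalPairR (· ≤ ·) C p q ∧ p ≤ a ∧ a ≤ q := by
  by_cases ho : Od C a
  · obtain ⟨c, d, hp, h1, h2, h3⟩ := exists_pair hC ho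
    refine ⟨c, d, hp, h1, ?_⟩
    exact (hC.1 a ha d hp.2.1).resolve_right h2
  · have h1 : (C.filter fun y => y ≤ a) = insert a (C.filter fun y => y < a) := by
      ext y; simp only [Finset.mem_filter, Finset.mem_insert]
      constructor
      · rintro ⟨h1, h2⟩
        rcases h2.eq_or_lt with h | h
        · exact Or.inl h
        · exact Or.inr ⟨h1, h⟩
      · rintro (rfl | h)
        · exact ⟨ha, le_rfl⟩
        · exact ⟨h.1, h.2.le⟩
    have h2 : Odd (C.filter fun y => y < a).card := by
      unfold Od at ho
      rw [h1, Finset.card_insert_of_notMem (by simp)] at ho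
      rw [Nat.odd_iff] at *
      omega
    obtain ⟨p, hp, hmax⟩ := (hC.1.mono (Finset.filter_subset (fun y => y < a) _)).max
      (Finset.card_pos.1 h2.pos)
    rw [Finset.mem_filter] at hp
    have e : (C.filter fun y => y ≤ p) = C.filter fun y => y < a := by
      ext y; simp only [Finset.mem_filter]
      exact ⟨fun h => ⟨h.1, h.2.trans_lt hp.2⟩, fun h => ⟨h.1, hmax y (Finset.mem_filter.2 h)⟩⟩
    refine ⟨p, a, ⟨hp.1, ha, hp.2.le, hp.2.ne, ?_, ?_⟩, hp.2.le, le_rfl⟩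
    · rw [e]; exact h2
    · intro c hc hpc hne
      rcases hC.1 a ha c hc with h | h
      · exact h
      · rcases h.eq_or_lt with h | h
        · exact h.ge
        · exact absurd (le_antisymm (hmax c (Finset.mem_filter.2 ⟨hc, h⟩)) hpc) hne

theorem Le'_of_KalLER {C D : Finset P} (hC : EC C) (hD : EC D) (h : KalLER (· ≤ ·) C D) :
    Le' C D := by
  have hch : ∀ a ∈ C, ∀ d ∈ D, a ≤ d ∨ d ≤ a := by
    intro a ha d hd
    obtain ⟨p, q, hpq, h1, h2⟩ := mem_pair hC ha
    obtain ⟨c, e, hce, h3, h4⟩ := h p q hpq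
    by_cases hdc : d ≤ c
    · exact Or.inr (hdc.trans (h3.trans h1))
    · have hcd : c ≤ d := (hD.1 c hce.1 d hd).resolve_right hdc
      have := hce.2.2.2.2.2 d hd hcd (fun h => hdc h.le)
      exact Or.inl (h2.trans (h4.trans this))
  have hU : Ch (C ∪ D) := by
    intro a ha b hb
    rcases Finset.mem_union.1 ha with ha | ha <;> rcases Finset.mem_union.1 hb with hb | hb
    · exact hC.1 a ha b hb
    · exact hch a ha b hb
    · exact (hch b hb a ha).symm
    · exact hD.1 a ha b hb
  refine ⟨hU, ?_⟩
  intro x hx ho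
  obtain ⟨p, q, hpq, h1, h2, -⟩ := exists_pair hC ho
  obtain ⟨c, e, hce, h3, h4⟩ := h p q hpq
  have hxq : x ≤ q := (hU x hx q (Finset.mem_union_left _ hpq.2.1)).resolve_right h2
  have e : (D.filter fun y => y ≤ x) = D.filter fun y => y ≤ c := by
    ext y; simp only [Finset.mem_filter]
    refine ⟨fun h => ⟨h.1, ?_⟩, fun h => ⟨h.1, h.2.trans (h3.trans h1)⟩⟩
    by_contra hyc
    have hcy : c ≤ y := (hD.1 c hce.1 y h.1).resolve_right hyc
    have := hce.2.2.2.2.2 y h.1 hcy (fun h => hyc h.le)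
    exact h2 (h4.trans (this.trans h.2))
  unfold Od
  rw [e]
  exact hce.2.2.2.2.1

theorem KalLER_of_Le' {C D : Finset P} (hD : EC D) (h : Le' C D) :
    KalLER (· ≤ ·) C D := by
  intro a b hab
  have ha : a ∈ C ∪ D := Finset.mem_union_left _ hab.1
  have hb : b ∈ C ∪ D := Finset.mem_union_left _ hab.2.1
  obtain ⟨c, d, hcd, h1, h2, h3⟩ := exists_pair hD (h.2 a ha hab.2.2.2.2.1)
  refine ⟨c, d, hcd, h1, ?_⟩
  have hd : d ∈ C ∪ D := Finset.mem_union_right _ hcd.2.1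
  by_contra hbd
  have hdb : d ≤ b := (h.1 d hd b hb).resolve_right hbd
  have had : a ≤ d := (h.1 a ha d hd).resolve_right h2
  have e1 : (C.filter fun y => y ≤ d) = C.filter fun y => y ≤ a := by
    ext y; simp only [Finset.mem_filter]
    refine ⟨fun h' => ⟨h'.1, ?_⟩, fun h => ⟨h.1, h.2.trans had⟩⟩
    by_contra hya
    have hay : a ≤ y := (h.1 a ha y (Finset.mem_union_left _ h'.1)).resolve_right hya
    exact hbd ((hab.2.2.2.2.2 y h'.1 hay (fun h => hya h.le)).trans h'.2)
  have h4 : Od D d := h.2 d hd (by unfold Od; rw [e1]; exact hab.2.2.2.2.1)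
  have e2 : (D.filter fun y => y ≤ d) = insert d (D.filter fun y => y ≤ c) := by
    ext y; simp only [Finset.mem_filter, Finset.mem_insert]
    constructor
    · rintro ⟨hy, hyd⟩
      by_cases hyc : y ≤ c
      · exact Or.inr ⟨hy, hyc⟩
      · have hcy : c ≤ y := (hD.1 c hcd.1 y hy).resolve_right hyc
        exact Or.inl (le_antisymm hyd (hcd.2.2.2.2.2 y hy hcy (fun h => hyc h.le)))
    · rintro (rfl | h)
      · exact ⟨hcd.2.1, le_rfl⟩
      · exact ⟨h.1, h.2.trans hcd.2.2.1⟩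
  have h5 : Odd (D.filter fun y => y ≤ c).card := hcd.2.2.2.2.1
  unfold Od at h4
  rw [e2, Finset.card_insert_of_notMem] at h4
  · rw [Nat.odd_iff] at *
    omega
  · intro hm
    exact hcd.2.2.2.1 (le_antisymm hcd.2.2.1 (Finset.mem_filter.1 hm).2)

theorem KalLER_trans (C D E : Finset P) (h1 : KalLER (· ≤ ·) C D) (h2 : KalLER (· ≤ ·) D E) :
    KalLER (· ≤ ·) C E := by
  intro a b hab
  obtain ⟨c, d, hcd, h3, h4⟩ := h1 a b hab
  obtain ⟨e, f, hef, h5, h6⟩ := h2 c d hcd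
  exact ⟨e, f, hef, h5.trans h3, h4.trans h6⟩

theorem KalLER_refl (C : Finset P) : KalLER (· ≤ ·) C C :=
  fun a b h => ⟨a, b, h, le_rfl, le_rfl⟩

theorem symmDiff_sub (C D : Finset P) : symmDiff C D ⊆ C ∪ D := by
  intro x; simp only [Finset.mem_symmDiff, Finset.mem_union]; tauto

theorem EC_symmDiff {C D : Finset P} (hC : EC C) (hD : EC D) (h : Ch (C ∪ D)) :
    EC (symmDiff C D) := by
  refine ⟨h.mono (symmDiff_sub C D), ?_⟩
  have h1 := hC.2
  have h2 := hD.2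
  rw [← Nat.not_odd_iff_even] at *
  rw [odd_symmDiff_card]
  tauto

theorem KalLER_symmDiff {C D : Finset P} (hC : EC C) (hD : EC D) (h : KalLER (· ≤ ·) C D) :
    EC (symmDiff D C) ∧ KalLER (· ≤ ·) (symmDiff D C) D := by
  have h' := Le'_of_KalLER hC hD h
  rw [symmDiff_comm]
  have h1 := EC_symmDiff hC hD h'.1
  refine ⟨h1, KalLER_of_Le' hD ?_⟩
  have hs : symmDiff C D ∪ D ⊆ C ∪ D := Finset.union_subset (symmDiff_sub C D) Finset.subset_union_right
  refine ⟨h'.1.mono hs, ?_⟩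
  intro x hx
  rw [Od_symmDiff]
  have := h'.2 x (hs hx)
  tauto

theorem EC_empty : EC (∅ : Finset P) := ⟨by simp [Ch], by simp⟩

theorem KalLER_empty (D : Finset P) : KalLER (· ≤ ·) (∅ : Finset P) D := by
  intro a b h; simp [KalPairR] at h

end kalorder
end Kal

namespace Kal
section ea
variable {P : Type u}

/-- ternary relation `a ⊕ b = c` -/
def R (A : EffectAlgebra P) (a b c : P) : Prop := A.D a b ∧ A.add a b = c

variable {A : EffectAlgebra P}

theorem R.comm {a b c : P} (h : R A a b c) : R A b a c :=
  ⟨A.D_comm h.1, by rw [← A.add_comm h.1, h.2]⟩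

theorem R.assoc {a b c e f : P} (h1 : R A a b e) (h2 : R A e c f) :
    ∃ g, R A b c g ∧ R A a g f := by
  obtain ⟨d1, rfl⟩ := h1
  obtain ⟨d2, rfl⟩ := h2
  exact ⟨_, ⟨A.D_of_assoc d1 d2, rfl⟩, A.D_assoc d1 d2, (A.add_assoc d1 d2).symm⟩

theorem R.assoc' {a b c f g : P} (h1 : R A b c g) (h2 : R A a g f) :
    ∃ e, R A a b e ∧ R A e c f := by
  obtain ⟨e, h3, h4⟩ := R.assoc h1.comm h2.comm
  exact ⟨e, h3.comm, h4.comm⟩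

theorem R.func {a b c c' : P} (h1 : R A a b c) (h2 : R A a b c') : c = c' := h1.2.symm.trans h2.2

theorem R.uniq {a b b' : P} (h1 : R A a b A.one) (h2 : R A a b' A.one) : b = b' :=
  (A.orthosupplement a).unique h1 h2

theorem R_orth (a : P) : ∃ b, R A a b A.one := (A.orthosupplement a).exists

theorem R_one_zero : R A A.one A.zero A.one := by
  obtain ⟨x, hx⟩ := R_orth (A := A) A.one
  have : x = A.zero := A.D_one hx.comm.1
  rwa [this] at hx

theorem R_zero (a : P) : R A a A.zero a := by
  obtain ⟨b, hb⟩ := R_orth (A := A) a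
  obtain ⟨g, h1, h2⟩ := hb.comm.assoc R_one_zero
  rwa [R.uniq h2 hb.comm] at h1

theorem R.cancel {a b b' c : P} (h1 : R A a b c) (h2 : R A a b' c) : b = b' := by
  obtain ⟨c', hc⟩ := R_orth (A := A) c
  obtain ⟨h, k1, k2⟩ := h1.comm.assoc hc
  obtain ⟨h', k3, k4⟩ := h2.comm.assoc hc
  obtain rfl := k1.func k3
  exact R.uniq k2.comm k4.comm

theorem R.sub {a b c : P} (h : R A a b c) : A.sub c a = b := by
  have h' : ∃ x, A.D a x ∧ A.add a x = c := ⟨b, h⟩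
  have : R A a (A.sub c a) c := by
    unfold EffectAlgebra.sub
    rw [dif_pos h']
    exact h'.choose_spec
  exact this.cancel h

variable [PartialOrder P] [BoundedOrder P]

theorem R_sub (hA : CompatEA P A) {a b : P} (h : a ≤ b) : R A a (A.sub b a) b := by
  obtain ⟨c, hc⟩ := (hA.2.2 a b).2 h
  rwa [R.sub hc]

theorem R.le (hA : CompatEA P A) {a b c : P} (h : R A a b c) : a ≤ c := (hA.2.2 a c).1 ⟨b, h⟩

theorem sub_le (hA : CompatEA P A) {a b : P} (h : a ≤ b) : A.sub b a ≤ b := (R_sub hA h).comm.le hA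

theorem sub_sub (hA : CompatEA P A) {a b : P} (h : a ≤ b) : A.sub b (A.sub b a) = a :=
  (R_sub hA h).comm.sub

theorem sub_self (a : P) : A.sub a a = A.zero := (R_zero a).sub
theorem sub_zero (a : P) : A.sub a A.zero = a := (R_zero a).comm.sub

theorem zero_le (hA : CompatEA P A) (a : P) : A.zero ≤ a := (R_zero a).comm.le hA

theorem R_iff (hA : CompatEA P A) {a b c : P} : R A a b c ↔ a ≤ c ∧ A.sub c a = b :=
  ⟨fun h => ⟨h.le hA, h.sub⟩, fun h => h.2 ▸ R_sub hA h.1⟩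

theorem le_eq (hA : CompatEA P A) : A.le = ((· ≤ ·) : P → P → Prop) := by
  funext a b; exact propext (hA.2.2 a b)

/-- alternating difference -/
noncomputable def alt (A : EffectAlgebra P) (C : Finset P) : P :=
  (chainSortR ((· ≤ ·) : P → P → Prop) C).foldl (fun v x => A.sub x v) A.zero

theorem alt_empty : alt A ∅ = A.zero := by simp [alt, chainSortR]

theorem alt_insert {C : Finset P} (h : Ch C) {x : P} (hx : ∀ y ∈ C, y < x) :
    alt A (insert x C) = A.sub x (alt A C) := by
  unfold alt; rw [chainSort_insert h hx]; simp

theorem alt_le (hA : CompatEA P A) : ∀ C : Finset P, Ch C → ∀ x, (∀ y ∈ C, y ≤ x) → alt A C ≤ x := by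
  apply Ch.ind
  · intro x _; rw [alt_empty]; exact zero_le hA x
  · intro z C hz hC ih x hx
    rw [alt_insert hC hz]
    exact (sub_le hA (ih z fun y hy => (hz y hy).le)).trans (hx z (by simp))

theorem alt_symmDiff (hA : CompatEA P A) {G : Finset P} (hG : Ch G) {x : P} (hx : ∀ y ∈ G, y ≤ x) :
    alt A (symmDiff {x} G) = A.sub x (alt A G) := by
  by_cases hm : x ∈ G
  · have e : symmDiff {x} G = G.erase x := by
      ext y; simp only [Finset.mem_symmDiff, Finset.mem_singleton, Finset.mem_erase]
      by_cases hy : y = x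
      · subst hy; simp [hm]
      · simp [hy]
    have h1 : Ch (G.erase x) := hG.mono (Finset.erase_subset _ _)
    have h2 : ∀ y ∈ G.erase x, y < x := fun y hy =>
      lt_of_le_of_ne (hx y (Finset.mem_of_mem_erase hy)) (Finset.ne_of_mem_erase hy)
    have h3 := alt_insert (A := A) h1 h2
    rw [Finset.insert_erase hm] at h3
    rw [e, h3, sub_sub hA (alt_le hA _ h1 _ fun y hy => (h2 y hy).le)]
  · rw [symmDiff_single_insert x G hm, alt_insert hG]
    exact fun y hy => lt_of_le_of_ne (hx y hy) (fun h => hm (h ▸ hy))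

theorem foldl_eq (hA : CompatEA P A) : ∀ (n : ℕ) (l : List P), l.length = 2 * n →
    l.Pairwise (· ≤ ·) → ∀ v, (∀ y ∈ l, v ≤ y) →
    R A v (eaSumList A l) (l.foldl (fun v x => A.sub x v) v) := by
  intro n
  induction n with
  | zero =>
    intro l hl _ v _
    have : l = [] := List.length_eq_zero_iff.1 (by omega)
    subst this
    exact R_zero v
  | succ n ih =>
    intro l hl hp v hv
    match l, hl with
    | [a], hl => simp at hl; omega
    | a :: b :: l, hl =>
      simp only [List.length_cons] at hl
      rw [List.pairwise_cons, List.pairwise_cons] at hp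
      have hva : v ≤ a := hv a (by simp)
      have hab : a ≤ b := hp.1 b (by simp)
      have k1 : R A v (A.sub b a) (A.sub b (A.sub a v)) := by
        obtain ⟨g, h1, h2⟩ := (R_sub hA hva).comm.assoc (R_sub hA hab)
        rwa [h2.sub]
      have k2 := sub_le hA ((sub_le hA hva).trans hab)
      obtain ⟨g, h1, h2⟩ := k1.assoc (ih l (by omega) hp.2.2 _ (fun y hy => k2.trans (hp.2.1 y hy)))
      rw [← h1.2] at h2
      exact h2

theorem eaM_eq_alt (hA : CompatEA P A) {C : Finset P} (hC : EC C) : eaM A C = alt A C := by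
  unfold eaM alt
  rw [le_eq hA]
  obtain ⟨n, hn⟩ := hC.2
  have := foldl_eq hA n (chainSortR (· ≤ ·) C) (by
    rw [(chainSort_perm C).length_eq, Finset.length_toList]; omega) (chainSort_pairwise hC.1)
    A.zero (fun y _ => zero_le hA y)
  exact (R_zero _).comm.func this

/-- measure of `C` below `t` -/
noncomputable def M (A : EffectAlgebra P) (C : Finset P) (t : P) : P :=
  if Odd C.card then A.sub t (alt A C) else alt A C

theorem M_erase (hA : CompatEA P A) {C : Finset P} {x : P} (hC : Ch C) (hx : ∀ y ∈ C, y ≤ x) :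
    M A C x = M A (C.erase x) x := by
  by_cases hm : x ∈ C
  · have h1 : Ch (C.erase x) := hC.mono (Finset.erase_subset _ _)
    have h2 : ∀ y ∈ C.erase x, y < x := fun y hy =>
      lt_of_le_of_ne (hx y (Finset.mem_of_mem_erase hy)) (Finset.ne_of_mem_erase hy)
    have h3 := alt_insert (A := A) h1 h2
    rw [Finset.insert_erase hm] at h3
    have h4 := Finset.card_erase_add_one hm
    have h5 : Odd C.card ↔ ¬ Odd (C.erase x).card := by rw [Nat.odd_iff, Nat.odd_iff]; omega
    unfold M
    rw [h3, sub_sub hA (alt_le hA _ h1 _ fun y hy => (h2 y hy).le)]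
    by_cases h6 : Odd (C.erase x).card <;> simp [h5, h6]
  · rw [Finset.erase_eq_of_notMem hm]

theorem M_even {C : Finset P} (hC : ¬ Odd C.card) (t : P) : M A C t = alt A C := if_neg hC

theorem M_odd (hA : CompatEA P A) {C : Finset P} {x t : P} (hC : Ch C) (hx : ∀ y ∈ C, y ≤ x)
    (hxt : x ≤ t) (ho : Odd C.card) : R A (M A C x) (A.sub t x) (M A C t) := by
  unfold M
  rw [if_pos ho, if_pos ho]
  obtain ⟨g, h1, h2⟩ := (R_sub hA (alt_le hA C hC x hx)).assoc (R_sub hA hxt)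
  rwa [h2.sub]

theorem key (hA : CompatEA P A) : ∀ L : Finset P, Ch L → ∀ C D, C ⊆ L → D ⊆ L →
    (∀ x ∈ L, Od C x → Od D x) → ∀ t, (∀ x ∈ L, x ≤ t) →
    R A (M A C t) (M A (symmDiff C D) t) (M A D t) := by
  apply Ch.ind
  · intro C D hC hD _ t _
    obtain rfl := Finset.subset_empty.1 hC
    obtain rfl := Finset.subset_empty.1 hD
    have : M A ∅ t = A.zero := by simp [M, alt_empty]
    rw [symmDiff_self, Finset.bot_eq_empty, this]
    exact R_zero _
  · intro x L hx hL ih C D hC hD hod t ht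
    have hle : ∀ y ∈ insert x L, y ≤ x := by
      intro y hy
      rcases Finset.mem_insert.1 hy with rfl | hy
      · exact le_rfl
      · exact (hx y hy).le
    have hL' : Ch (insert x L) := by
      intro a ha b hb
      rcases Finset.mem_insert.1 ha with h1 | h1
      · exact Or.inr (h1 ▸ hle b hb)
      · rcases Finset.mem_insert.1 hb with h2 | h2
        · exact Or.inl (h2 ▸ hle a ha)
        · exact hL a h1 b h2
    have hS : symmDiff C D ⊆ insert x L := (symmDiff_sub C D).trans (Finset.union_subset hC hD)
    have er : ∀ {C}, C ⊆ insert x L → C.erase x ⊆ L := by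
      intro C h y hy
      exact (Finset.mem_insert.1 (h (Finset.mem_of_mem_erase hy))).resolve_left
        (Finset.ne_of_mem_erase hy)
    have od : ∀ C : Finset P, ∀ y ∈ L, Od (C.erase x) y ↔ Od C y := by
      intro C y hy
      unfold Od
      have : ((C.erase x).filter fun z => z ≤ y) = C.filter fun z => z ≤ y := by
        ext z; simp only [Finset.mem_filter, Finset.mem_erase]
        refine ⟨fun h => ⟨h.1.2, h.2⟩, fun h => ⟨⟨?_, h.1⟩, h.2⟩⟩
        rintro rfl
        exact absurd (hx y hy) (not_lt_of_ge h.2)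
      rw [this]
    have odx : ∀ {C : Finset P}, C ⊆ insert x L → (Od C x ↔ Odd C.card) := by
      intro C h
      unfold Od
      rw [Finset.filter_true_of_mem (fun y hy => hle y (h hy))]
    have h1 := ih (C.erase x) (D.erase x) (er hC) (er hD)
      (fun y hy => by rw [od C y hy, od D y hy]; exact hod y (Finset.mem_insert_of_mem hy)) x
      (fun y hy => (hx y hy).le)
    have e : symmDiff (C.erase x) (D.erase x) = (symmDiff C D).erase x := by
      ext y; simp only [Finset.mem_symmDiff, Finset.mem_erase]; tauto
    rw [e, ← M_erase hA (hL'.mono hC) fun y hy => hle y (hC hy),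
      ← M_erase hA (hL'.mono hD) fun y hy => hle y (hD hy),
      ← M_erase hA (hL'.mono hS) fun y hy => hle y (hS hy)] at h1
    have hxt : x ≤ t := ht x (by simp)
    have hpar := hod x (by simp)
    rw [odx hC, odx hD] at hpar
    have hsp := odd_symmDiff_card C D
    have ev : ∀ {C : Finset P}, ¬ Odd C.card → M A C t = M A C x := by
      intro C h; rw [M_even h, M_even h]
    have mo : ∀ {C : Finset P}, C ⊆ insert x L → Odd C.card →
        R A (M A C x) (A.sub t x) (M A C t) := by
      intro C h ho; exact M_odd hA (hL'.mono h) (fun y hy => hle y (h hy)) hxt ho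
    by_cases c1 : Odd C.card
    · have c2 := hpar c1
      have c3 : ¬ Odd (symmDiff C D).card := by tauto
      rw [ev c3]
      obtain ⟨g, k1, k2⟩ := h1.comm.assoc (mo hD c2)
      rw [(mo hC c1).func k1]
      exact k2.comm
    · by_cases c2 : Odd D.card
      · have c3 : Odd (symmDiff C D).card := by tauto
        rw [ev c1]
        obtain ⟨g, k1, k2⟩ := h1.assoc (mo hD c2)
        rw [(mo hS c3).func k1]
        exact k2
      · have c3 : ¬ Odd (symmDiff C D).card := by tauto
        rw [ev c1, ev c2, ev c3]
        exact h1

theorem eaM_symmDiff (hA : CompatEA P A) {C D : Finset P} (hC : EC C) (hD : EC D)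
    (h : KalLER (· ≤ ·) C D) : R A (eaM A C) (eaM A (symmDiff D C)) (eaM A D) := by
  have h' := Le'_of_KalLER hC hD h
  have hS := (KalLER_symmDiff hC hD h).1
  have := key hA (C ∪ D) h'.1 C D Finset.subset_union_left Finset.subset_union_right h'.2 ⊤
    (fun _ _ => le_top)
  rw [symmDiff_comm C D, M_even (Nat.not_odd_iff_even.2 hC.2), M_even (Nat.not_odd_iff_even.2 hD.2),
    M_even (Nat.not_odd_iff_even.2 hS.2)] at this
  rwa [eaM_eq_alt hA hC, eaM_eq_alt hA hD, eaM_eq_alt hA hS]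

theorem EC_kalMapF {Q : Type v} [PartialOrder Q] {f : P → Q} (hf : Monotone f)
    {C : Finset P} (hC : EC C) : EC (kalMapF f C) := by
  refine ⟨?_, ?_⟩
  · intro a ha b hb
    obtain ⟨x, hx, rfl⟩ := kalMapF_sub f C a ha
    obtain ⟨y, hy, rfl⟩ := kalMapF_sub f C b hb
    exact (hC.1 x hx y hy).imp (fun h => hf h) (fun h => hf h)
  · rw [← Nat.not_odd_iff_even, kalMapF_odd, Nat.not_odd_iff_even]; exact hC.2

theorem eta_eq (a : P) : kalEtaF ⊥ a = symmDiff {a} {⊥} := by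
  unfold kalEtaF
  split_ifs with h
  · subst h; simp
  · rw [symmDiff_single_insert _ _ (by simpa using h)]
    ext y; simp [or_comm]

theorem Ch_single (a : P) : Ch ({a} : Finset P) := by
  intro x hx y hy; simp only [Finset.mem_singleton] at hx hy; subst hx; subst hy; simp

theorem alt_single (hA : CompatEA P A) (a : P) : alt A {a} = a := by
  have := alt_symmDiff hA (G := ∅) (x := a) (by simp [Ch]) (by simp)
  rwa [alt_empty, sub_zero, symmDiff_emp] at this

theorem alt_pair (hA : CompatEA P A) {a b : P} (h : a ≤ b) :
    alt A (symmDiff {b} {a}) = A.sub b a := by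
  rw [alt_symmDiff hA (Ch_single a) (by simpa using h), alt_single hA]

theorem EC_pair {a b : P} (h : a ≤ b) : EC (symmDiff {b} {a} : Finset P) := by
  refine ⟨?_, ?_⟩
  · refine Ch.mono (D := {a, b}) ?_ ?_
    · intro x hx y hy
      simp only [Finset.mem_insert, Finset.mem_singleton] at hx hy
      rcases hx with rfl | rfl <;> rcases hy with rfl | rfl <;> simp [h]
    · refine (symmDiff_sub _ _).trans ?_
      intro x; simp; tauto
  · rw [← Nat.not_odd_iff_even, odd_symmDiff_card]; simp

theorem eaM_pair (hA : CompatEA P A) {a b : P} (h : a ≤ b) :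
    eaM A (symmDiff {b} {a}) = A.sub b a := by
  rw [eaM_eq_alt hA (EC_pair h), alt_pair hA h]

theorem mu_law (hA : CompatEA P A) (𝒞 : Finset (Finset P)) (hch : ∀ X ∈ 𝒞, ∀ Y ∈ 𝒞,
    KalLER (· ≤ ·) X Y ∨ KalLER (· ≤ ·) Y X) : (∀ X ∈ 𝒞, EC X) →
    EC (kalMuF 𝒞) ∧ (∀ Z, (∀ X ∈ 𝒞, KalLER (· ≤ ·) X Z) → KalLER (· ≤ ·) (kalMuF 𝒞) Z) ∧
    Ch (kalMapF (eaM A) 𝒞) ∧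
    eaM A (kalMuF 𝒞) = alt A (kalMapF (eaM A) 𝒞) := by
  revert 𝒞
  apply chain_ind' (KalLER ((· ≤ ·) : P → P → Prop)) KalLER_refl KalLER_trans
  · intro _
    rw [kalMuF_empty, kalMapF_empty]
    exact ⟨EC_empty, fun Z _ => KalLER_empty Z, EC_empty.1, eaM_eq_alt hA EC_empty⟩
  · intro X 𝒞 𝒞' hX hm hle ih hEC
    have hECX : EC X := hEC X ((hm X).2 (Or.inl rfl))
    have hEC' : ∀ Y ∈ 𝒞, EC Y := fun Y hY => hEC Y ((hm Y).2 (Or.inr hY))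
    obtain ⟨i1, i2, i3, i4⟩ := ih hEC'
    rw [kalMuF_insert X 𝒞 _ hX hm, kalMapF_insert' _ X 𝒞 _ hX hm]
    have hb := KalLER_symmDiff i1 hECX (i2 X hle)
    have hbd : ∀ y ∈ kalMapF (eaM A) 𝒞, y ≤ eaM A X := by
      intro y hy
      obtain ⟨Y, hY, rfl⟩ := kalMapF_sub _ _ _ hy
      exact (eaM_symmDiff hA (hEC' Y hY) hECX (hle Y hY)).le hA
    refine ⟨hb.1, fun Z hZ => KalLER_trans _ _ _ hb.2 (hZ X ((hm X).2 (Or.inl rfl))), ?_, ?_⟩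
    · refine Ch.mono ?_ (symmDiff_sub _ _)
      intro a ha b hb
      rw [Finset.mem_union, Finset.mem_singleton] at ha hb
      rcases ha with rfl | ha <;> rcases hb with hb | hb
      · exact Or.inl hb.ge
      · exact Or.inr (hbd b hb)
      · exact Or.inl (hb ▸ hbd a ha)
      · exact i3 a ha b hb
    · rw [alt_symmDiff hA i3 hbd, ← i4]
      exact (eaM_symmDiff hA i1 hECX (i2 X hle)).sub.symm

theorem part1 (hA : CompatEA P A) : IsEMAlgebra P (eaM A) := by
  have heta : ∀ a : P, eaM A (symmDiff {a} {⊥}) = a := by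
    intro a
    rw [eaM_pair hA bot_le, ← hA.1, sub_zero]
  refine ⟨?_, ?_, ?_, ?_, ?_⟩
  · intro C hC D hD h
    rw [mem_car] at hC hD
    exact (eaM_symmDiff hA hC hD h).le hA
  · rw [eaM_eq_alt hA EC_empty, alt_empty, hA.1]
  · by_cases h : (⊤ : P) = ⊥
    · have : ∀ a b : P, a = b := fun a b => le_antisymm
        ((le_top.trans h.le).trans bot_le) ((le_top.trans h.le).trans bot_le)
      exact this _ _
    · have e : ({⊥, ⊤} : Finset P) = symmDiff {⊤} {⊥} := by
        rw [symmDiff_single_insert _ _ (by simpa using h)]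
        ext y; simp [or_comm]
      rw [e, heta]
  · intro a; rw [eta_eq, heta]
  · intro 𝒞 h𝒞
    have hEC : ∀ X ∈ 𝒞, EC X := fun X hX => (mem_car X).1 (h𝒞.1 hX)
    obtain ⟨i1, i2, i3, i4⟩ := mu_law hA 𝒞 h𝒞.2.1 hEC
    rw [i4]
    apply eaM_eq_alt hA
    refine ⟨i3, ?_⟩
    rw [← Nat.not_odd_iff_even, kalMapF_odd, Nat.not_odd_iff_even]; exact h𝒞.2.2

theorem part3 {B : EffectAlgebra P} (hA : CompatEA P A) (hB : CompatEA P B)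
    (h : ∀ C ∈ KalCarrier Set.univ ((· ≤ ·) : P → P → Prop), eaM A C = eaM B C) (a b : P) :
    (A.D a b ↔ B.D a b) ∧ (A.D a b → A.add a b = B.add a b) := by
  have hR : ∀ c, R A a b c ↔ R B a b c := by
    intro c
    rw [R_iff hA, R_iff hB]
    refine and_congr_right fun hac => ?_
    have := h _ ((mem_car _).2 (EC_pair hac))
    rw [eaM_pair hA hac, eaM_pair hB hac] at this
    rw [this]
  refine ⟨⟨fun hd => ((hR _).1 ⟨hd, rfl⟩).1, fun hd => ((hR _).2 ⟨hd, rfl⟩).1⟩, ?_⟩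
  intro hd
  exact ((hR _).1 ⟨hd, rfl⟩).2.symm

theorem part4 {Q : Type v} [PartialOrder Q] [BoundedOrder Q] {B : EffectAlgebra Q}
    (hA : CompatEA P A) (hB : CompatEA Q B) (f : P → Q) :
    A.Hom B f ↔
          (Monotone f ∧ f ⊥ = ⊥ ∧ f ⊤ = ⊤ ∧
            ∀ C ∈ KalCarrier Set.univ ((· ≤ ·) : P → P → Prop),
              f (eaM A C) = eaM B (kalMapF f C)) := by
  constructor
  · rintro ⟨h1, h2⟩
    have hR : ∀ {a b c}, R A a b c → R B (f a) (f b) (f c) := by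
      rintro a b c ⟨hd, rfl⟩
      exact ⟨(h2 a b hd).1, (h2 a b hd).2.symm⟩
    have hmono : Monotone f := fun a b hab => (hR (R_sub hA hab)).le hB
    have h0 : f A.zero = B.zero := (hR (R_zero A.zero)).cancel (R_zero _)
    refine ⟨hmono, by rw [← hA.1, ← hB.1, h0], by rw [← hA.2.1, ← hB.2.1, h1], ?_⟩
    intro C hC
    rw [mem_car] at hC
    rw [eaM_eq_alt hA hC, eaM_eq_alt hB (EC_kalMapF hmono hC)]
    have : ∀ C : Finset P, Ch C → (Ch (kalMapF f C) ∧ f (alt A C) = alt B (kalMapF f C)) := by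
      apply Ch.ind
      · rw [kalMapF_empty, alt_empty, alt_empty]
        exact ⟨EC_empty.1, h0⟩
      · intro x C hx hC ih
        have hxC : x ∉ C := fun hm => lt_irrefl _ (hx x hm)
        have hbd : ∀ y ∈ kalMapF f C, y ≤ f x := by
          intro y hy
          obtain ⟨z, hz, rfl⟩ := kalMapF_sub _ _ _ hy
          exact hmono (hx z hz).le
        rw [kalMapF_insert f x C hxC]
        refine ⟨?_, ?_⟩
        · refine Ch.mono ?_ (symmDiff_sub _ _)
          intro a ha b hb
          rw [Finset.mem_union, Finset.mem_singleton] at ha hb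
          rcases ha with rfl | ha <;> rcases hb with hb | hb
          · exact Or.inl hb.ge
          · exact Or.inr (hbd b hb)
          · exact Or.inl (hb ▸ hbd a ha)
          · exact ih.1 a ha b hb
        · rw [alt_insert hC hx, alt_symmDiff hB ih.1 hbd, ← ih.2]
          exact (hR (R_sub hA (alt_le hA C hC x fun y hy => (hx y hy).le))).sub.symm
    exact (this C hC.1).2
  · rintro ⟨hmono, h0, h1, hC⟩
    refine ⟨by rw [hA.2.1, hB.2.1, h1], ?_⟩
    have hsub : ∀ a c, a ≤ c → f (A.sub c a) = B.sub (f c) (f a) := by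
      intro a c hac
      rcases hac.eq_or_lt with rfl | hlt
      · rw [sub_self, sub_self, hA.1, hB.1, h0]
      · have := hC _ ((mem_car _).2 (EC_pair hac))
        rw [eaM_pair hA hac] at this
        have hne : c ∉ ({a} : Finset P) := by simpa using hlt.ne'
        rw [this, symmDiff_single_insert _ _ hne, kalMapF_insert f c _ hne]
        have e : kalMapF f {a} = {f a} := by
          have := kalMapF_insert f a ∅ (by simp)
          rw [kalMapF_empty] at this
          simpa [symmDiff_emp] using this
        rw [e, eaM_pair hB (hmono hac)]
    intro a b hd
    have hr : R A a b (A.add a b) := ⟨hd, rfl⟩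
    have hle := hr.le hA
    have h3 := R_sub hB (hmono hle)
    rw [← hsub _ _ hle, hr.sub] at h3
    exact ⟨h3.1, h3.2.symm⟩

end ea
end Kal

namespace Kal
section dposet
variable {P : Type u} [PartialOrder P] [BoundedOrder P]

theorem of_dposet (d : P → P → P) (d1 : ∀ a b, a ≤ b → d b a ≤ b)
    (d2 : ∀ a b, a ≤ b → d b (d b a) = a)
    (d3 : ∀ a b c, a ≤ b → b ≤ c → d c b ≤ d c a)
    (d4 : ∀ a b c, a ≤ b → b ≤ c → d (d c a) (d c b) = d b a)
    (d5 : ∀ a, d a ⊥ = a) :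
    ∃ A : EffectAlgebra P, CompatEA P A ∧ ∀ a b, a ≤ b → A.sub b a = d b a := by
  let D : P → P → Prop := fun a b => b ≤ d ⊤ a
  let add : P → P → P := fun a b => d ⊤ (d (d ⊤ a) b)
  have hR : ∀ a b c, (D a b ∧ add a b = c) ↔ (a ≤ c ∧ d c a = b) := by
    intro a b c
    constructor
    · rintro ⟨h1, rfl⟩
      have h2 : d (d ⊤ a) b ≤ d ⊤ a := d1 _ _ h1
      have h3 := d3 _ _ ⊤ h2 le_top
      have h4 := d4 _ _ ⊤ h2 le_top
      rw [d2 a ⊤ le_top] at h3 h4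
      refine ⟨h3, ?_⟩
      change d (d ⊤ (d (d ⊤ a) b)) a = b
      rw [h4, d2 _ _ h1]
    · rintro ⟨h1, rfl⟩
      have h2 := d3 a c ⊤ h1 le_top
      have h3 := d4 a c ⊤ h1 le_top
      refine ⟨?_, ?_⟩
      · change d c a ≤ d ⊤ a
        rw [← h3]; exact d1 _ _ h2
      · change d ⊤ (d (d ⊤ a) (d c a)) = c
        rw [← h3, d2 _ _ h2, d2 _ _ le_top]
  have hcomm : ∀ a b c, (D a b ∧ add a b = c) → (D b a ∧ add b a = c) := by
    intro a b c h
    rw [hR] at *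
    obtain ⟨h1, rfl⟩ := h
    exact ⟨d1 _ _ h1, d2 _ _ h1⟩
  have hassoc : ∀ a b c, D a b → D (add a b) c → (D b c ∧ add b c = d (add (add a b) c) a) ∧
      (D a (d (add (add a b) c) a) ∧ add a (d (add (add a b) c) a) = add (add a b) c) := by
    intro a b c h1 h2
    obtain ⟨e1, e2⟩ := (hR a b _).1 ⟨h1, rfl⟩
    obtain ⟨f1, f2⟩ := (hR _ c _).1 ⟨h2, rfl⟩
    refine ⟨?_, (hR _ _ _).2 ⟨e1.trans f1, rfl⟩⟩
    apply hcomm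
    rw [hR]
    have h3 := d3 _ _ _ e1 f1
    have h4 := d4 _ _ _ e1 f1
    rw [f2] at h3 h4
    exact ⟨h3, h4.trans e2⟩
  have hdd : ∀ a, d a a = ⊥ := by
    intro a
    have := d2 ⊥ a bot_le
    rwa [d5] at this
  let A : EffectAlgebra P :=
    { D := D, add := add, zero := ⊥, one := ⊤
      D_comm := fun {a b} h => (hcomm a b _ ⟨h, rfl⟩).1
      add_comm := fun {a b} h => (hcomm a b _ ⟨h, rfl⟩).2.symm
      D_of_assoc := fun {a b c} h1 h2 => (hassoc a b c h1 h2).1.1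
      D_assoc := fun {a b c} h1 h2 => by
        obtain ⟨⟨_, h4⟩, h5, _⟩ := hassoc a b c h1 h2
        rw [h4]; exact h5
      add_assoc := fun {a b c} h1 h2 => by
        obtain ⟨⟨_, h4⟩, _, h6⟩ := hassoc a b c h1 h2
        rw [h4]; exact h6.symm
      orthosupplement := fun a => by
        refine ⟨d ⊤ a, (hR _ _ _).2 ⟨le_top, rfl⟩, ?_⟩
        intro y hy
        exact ((hR _ _ _).1 hy).2.symm
      D_one := fun {a} h => by
        have h1 : d ⊤ a = ⊤ := top_le_iff.1 h
        have h2 := d2 a ⊤ le_top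
        rw [h1, hdd] at h2
        exact h2.symm }
  refine ⟨A, ⟨rfl, rfl, ?_⟩, ?_⟩
  · intro a b
    constructor
    · rintro ⟨c, hc⟩
      exact ((hR _ _ _).1 hc).1
    · intro h
      exact ⟨d b a, (hR _ _ _).2 ⟨h, rfl⟩⟩
  · intro a b h
    have : R A a (d b a) b := (hR _ _ _).2 ⟨h, rfl⟩
    exact this.sub

theorem KalLER_pair {a b c d : P} (h1 : c ≤ a) (h2 : a ≤ b) (h3 : b ≤ d) :
    KalLER (· ≤ ·) (symmDiff {b} {a} : Finset P) (symmDiff {d} {c}) := by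
  apply KalLER_of_Le' (EC_pair (h1.trans (h2.trans h3)))
  refine ⟨?_, ?_⟩
  · have hC : Ch ({a, b, c, d} : Finset P) := by
      have h4 := h1.trans h2
      have h5 := h2.trans h3
      have h6 := h1.trans h5
      intro x hx y hy
      simp only [Finset.mem_insert, Finset.mem_singleton] at hx hy
      rcases hx with rfl | rfl | rfl | rfl <;> rcases hy with rfl | rfl | rfl | rfl <;> simp [*]
    refine hC.mono ?_
    refine (Finset.union_subset_union (symmDiff_sub _ _) (symmDiff_sub _ _)).trans ?_
    intro x; simp; tauto
  · intro x _
    rw [Od_symmDiff, Od_symmDiff, Od_single, Od_single, Od_single, Od_single]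
    intro h hcon
    apply h
    constructor
    · intro h; exact h2.trans h
    · intro h
      exact h3.trans (hcon.2 (h1.trans h))

theorem EM_sub {m : Finset P → P} (hm : IsEMAlgebra P m) {C D : Finset P} (hC : EC C) (hD : EC D)
    (h : KalLER (· ≤ ·) C D) : m (symmDiff D C) = m (symmDiff {m D} {m C}) := by
  by_cases hCD : C = D
  · subst hCD; rw [symmDiff_self, symmDiff_self]
  · have hn : D ∉ ({C} : Finset (Finset P)) := by
      rw [Finset.mem_singleton]; exact fun h => hCD h.symm
    have hmem : ∀ Y, Y ∈ ({D, C} : Finset (Finset P)) ↔ Y = D ∨ Y ∈ ({C} : Finset (Finset P)) := by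
      intro Y; simp
    have hmem0 : ∀ Y, Y ∈ ({C} : Finset (Finset P)) ↔ Y = C ∨ Y ∈ (∅ : Finset (Finset P)) := by
      intro Y; simp
    have := hm.2.2.2.2 {D, C} (by
      refine ⟨?_, ?_, ?_⟩
      · intro X hX
        rw [mem_car]
        simp only [Finset.coe_insert, Finset.coe_singleton, Set.mem_insert_iff,
          Set.mem_singleton_iff] at hX
        rcases hX with rfl | rfl
        · exact hD
        · exact hC
      · intro X hX Y hY
        rw [hmem, Finset.mem_singleton] at hX hY
        rcases hX with rfl | rfl <;> rcases hY with rfl | rfl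
        · exact Or.inl (KalLER_refl _)
        · exact Or.inr h
        · exact Or.inl h
        · exact Or.inl (KalLER_refl _)
      · rw [Finset.card_pair (fun h => hCD h.symm)]; exact even_two)
    rw [kalMapF_insert' m D {C} _ hn hmem, kalMapF_insert' m C ∅ _ (by simp) hmem0, kalMapF_empty,
      kalMuF_insert D {C} _ hn hmem, kalMuF_insert C ∅ _ (by simp) hmem0, kalMuF_empty,
      symmDiff_emp] at this
    have e : symmDiff C ∅ = C := by
      ext y; simp [Finset.mem_symmDiff]
    rw [e] at this
    exact this.symm

theorem part2 {m : Finset P → P} (hm : IsEMAlgebra P m) :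
    ∃ A : EffectAlgebra P, CompatEA P A ∧
          ∀ C ∈ KalCarrier Set.univ ((· ≤ ·) : P → P → Prop), eaM A C = m C := by
  have heta : ∀ a, m (symmDiff {a} {⊥}) = a := by
    intro a; rw [← eta_eq]; exact hm.2.2.2.1 a
  have hmono : ∀ {C D : Finset P}, EC C → EC D → KalLER (· ≤ ·) C D → m C ≤ m D := by
    intro C D hC hD h
    exact hm.1 C ((mem_car C).2 hC) D ((mem_car D).2 hD) h
  have hsd : ∀ a b c : P, symmDiff (symmDiff {c} {a}) (symmDiff {c} {b}) =
      (symmDiff {b} {a} : Finset P) := by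
    intro a b c
    ext y; simp only [Finset.mem_symmDiff]; tauto
  obtain ⟨A, hA, hsub⟩ := of_dposet (fun b a : P => m (symmDiff {b} {a}))
    (by
      intro a b h
      have := hmono (EC_pair h) (EC_pair bot_le) (KalLER_pair bot_le h le_rfl)
      rwa [heta] at this)
    (by
      intro a b h
      have := EM_sub hm (EC_pair h) (EC_pair bot_le) (KalLER_pair bot_le h le_rfl)
      rw [heta, hsd, heta] at this
      exact this.symm)
    (by
      intro a b c h1 h2
      exact hmono (EC_pair h2) (EC_pair (h1.trans h2)) (KalLER_pair h1 h2 le_rfl))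
    (by
      intro a b c h1 h2
      have := EM_sub hm (EC_pair h2) (EC_pair (h1.trans h2)) (KalLER_pair h1 h2 le_rfl)
      rw [hsd] at this
      exact this.symm)
    heta
  refine ⟨A, hA, ?_⟩
  intro C hC
  rw [mem_car] at hC
  rw [eaM_eq_alt hA hC]
  let E : Finset P → Finset P := fun C => if Odd C.card then symmDiff C {⊥} else C
  have main : ∀ C : Finset P, Ch C → (alt A C = m (E C)) := by
    apply Ch.ind
    · rw [alt_empty, hA.1]
      simp [E, hm.2.1]
    · intro x C hx hCh ih
      have hxC : x ∉ C := fun hm => lt_irrefl _ (hx x hm)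
      have hEs : ∀ y ∈ E C, y = ⊥ ∨ y ∈ C := by
        intro y hy
        simp only [E] at hy
        split_ifs at hy
        · have := symmDiff_sub _ _ hy
          simpa [or_comm] using this
        · exact Or.inr hy
      have hEx : ∀ y ∈ E C, y ≤ x := by
        intro y hy
        rcases hEs y hy with rfl | h
        · exact bot_le
        · exact (hx y h).le
      have hEch : Ch (E C) := by
        intro a ha b hb
        rcases hEs a ha with rfl | ha
        · exact Or.inl bot_le
        · rcases hEs b hb with rfl | hb
          · exact Or.inr bot_le
          · exact hCh a ha b hb
      have hEev : Even (E C).card := by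
        rw [← Nat.not_odd_iff_even]
        simp only [E]
        split_ifs with h
        · rw [odd_symmDiff_card]; simp [h]
        · exact h
      have hEC : EC (E C) := ⟨hEch, hEev⟩
      have hle : KalLER (· ≤ ·) (E C) (symmDiff {x} {⊥}) := by
        apply KalLER_of_Le' (EC_pair bot_le)
        refine ⟨?_, ?_⟩
        · refine Ch.mono (D := insert x (insert ⊥ (E C))) ?_ ?_
          · intro a ha b hb
            simp only [Finset.mem_insert] at ha hb
            rcases ha with rfl | rfl | ha
            · rcases hb with rfl | rfl | hb
              · exact Or.inl le_rfl
              · exact Or.inr bot_le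
              · exact Or.inr (hEx b hb)
            · exact Or.inl bot_le
            · rcases hb with hb | rfl | hb
              · exact Or.inl (hb ▸ hEx a ha)
              · exact Or.inr bot_le
              · exact hEch a ha b hb
          · refine (Finset.union_subset_union (le_refl _) (symmDiff_sub _ _)).trans ?_
            intro y; simp
        · intro y _ ho
          rw [Od_symmDiff, Od_single, Od_single]
          intro hcon
          have hxy : x ≤ y := hcon.2 bot_le
          unfold Od at ho
          rw [Finset.filter_true_of_mem (fun z hz => (hEx z hz).trans hxy)] at ho
          exact (Nat.not_odd_iff_even.2 hEev) ho
      have h1 := EM_sub hm hEC (EC_pair bot_le) hle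
      rw [heta, ← ih] at h1
      rw [alt_insert hCh hx, hsub _ _ (alt_le hA C hCh x fun y hy => (hx y hy).le), ← h1]
      congr 1
      have hodd : Odd (insert x C).card ↔ ¬ Odd C.card := by
        rw [← symmDiff_single_insert x C hxC, odd_symmDiff_card]; simp
      rw [← symmDiff_single_insert x C hxC] at hodd ⊢
      by_cases hc : Odd C.card
      · have e1 : E C = symmDiff C {⊥} := if_pos hc
        have e2 : E (symmDiff {x} C) = symmDiff {x} C := if_neg (by tauto)
        rw [e1, e2]
        ext y; simp only [Finset.mem_symmDiff]; tauto
      · have e1 : E C = C := if_neg hc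
        have e2 : E (symmDiff {x} C) = symmDiff (symmDiff {x} C) {⊥} := if_pos (by tauto)
        rw [e1, e2]
        ext y; simp only [Finset.mem_symmDiff]; tauto
  rw [main C hC.1]
  have : E C = C := if_neg (Nat.not_odd_iff_even.2 hC.2)
  rw [this]

end dposet
end Kal

/-- The category of effect algebras is isomorphic to the
Eilenberg-Moore category for the Kalmbach monad: (1) every effect algebra `A` yields
an Eilenberg-Moore algebra `(U A, m_A)`; (2) every Eilenberg-Moore algebra `(P, m)`
arises this way from an effect algebra on `P` with the same bounded order; (3) two
effect algebras with the same structure map agree; (4) under this correspondence a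
map is a morphism of effect algebras iff it is a morphism of Eilenberg-Moore
algebras. -/
theorem effect_algebras_eilenberg_moore_kalmbach :
    (∀ (P : Type u) [PartialOrder P] [BoundedOrder P] [Nontrivial P]
       (A : EffectAlgebra P), CompatEA P A → IsEMAlgebra P (eaM A)) ∧
    (∀ (P : Type u) [PartialOrder P] [BoundedOrder P] [Nontrivial P]
       (m : Finset P → P), IsEMAlgebra P m →
        ∃ A : EffectAlgebra P, CompatEA P A ∧
          ∀ C ∈ KalCarrier Set.univ ((· ≤ ·) : P → P → Prop), eaM A C = m C) ∧
    (∀ (P : Type u) [PartialOrder P] [BoundedOrder P] [Nontrivial P]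
       (A B : EffectAlgebra P), CompatEA P A → CompatEA P B →
        (∀ C ∈ KalCarrier Set.univ ((· ≤ ·) : P → P → Prop), eaM A C = eaM B C) →
        ∀ a b : P, (A.D a b ↔ B.D a b) ∧ (A.D a b → A.add a b = B.add a b)) ∧
    (∀ (P : Type u) (Q : Type u)
       [PartialOrder P] [BoundedOrder P] [Nontrivial P]
       [PartialOrder Q] [BoundedOrder Q] [Nontrivial Q]
       (A : EffectAlgebra P) (B : EffectAlgebra Q), CompatEA P A → CompatEA Q B →
        ∀ f : P → Q, A.Hom B f ↔
          (Monotone f ∧ f ⊥ = ⊥ ∧ f ⊤ = ⊤ ∧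
            ∀ C ∈ KalCarrier Set.univ ((· ≤ ·) : P → P → Prop),
              f (eaM A C) = eaM B (kalMapF f C))) := by
  refine ⟨?_, ?_, ?_, ?_⟩
  · intro P _ _ _ A hA
    exact Kal.part1 hA
  · intro P _ _ _ m hm
    exact Kal.part2 hm
  · intro P _ _ _ A B hA hB h a b
    exact Kal.part3 hA hB h a b
  · intro P Q _ _ _ _ _ _ A B hA hB f
    exact Kal.part4 hA hB f
end

section
/- Every effect algebra (E,⊕,0,1), equipped with its induced order and the operation b⊖a (defined for a ≤ b as the unique c with a⊕c=b), satisfies the D-poset axioms (D1)-(D3); conversely, given a D-poset (P,≤,⊖,0,1), defining a⊕b (for a ≤ 1⊖b) as 1⊖((1⊖a)⊖b) yields an effect algebra whose difference operation coincides with the original ⊖; these constructions are mutually inverse and identity on morphisms, giving an isomorphism between the category of D-posets and the category of effect algebras. -/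
attribute [local instance] Classical.propDecidable

universe u v w


/-- A D-poset: a bounded poset with a partial difference `⊖` (with domain predicate
`Ddef`, where `Ddef b a` means that `b ⊖ a` is defined) satisfying (D1)-(D3). -/
structure DPoset (P : Type u) : Type u where
  le : P → P → Prop
  zero : P
  one : P
  /-- `Ddef b a` means that `b ⊖ a` is defined. -/
  Ddef : P → P → Prop
  /-- the partial difference `diff b a = b ⊖ a` -/
  diff : P → P → P
  le_refl : ∀ a, le a a
  le_antisymm : ∀ {a b}, le a b → le b a → a = b
  le_trans : ∀ {a b c}, le a b → le b c → le a c
  zero_le : ∀ a, le zero a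
  le_one : ∀ a, le a one
  /-- (D1) -/
  d1 : ∀ a b, Ddef b a ↔ le a b
  /-- (D2) -/
  d2a : ∀ {a b}, le a b → le (diff b a) b
  /-- (D2) -/
  d2b : ∀ {a b}, le a b → diff b (diff b a) = a
  /-- (D3) -/
  d3a : ∀ {a b c}, le a b → le b c → le (diff c b) (diff c a)
  /-- (D3) -/
  d3b : ∀ {a b c}, le a b → le b c → diff (diff c a) (diff c b) = diff b a

/-- A morphism of D-posets. -/
def DPoset.Hom {P : Type u} {Q : Type v} (Dp : DPoset P) (Dq : DPoset Q) (f : P → Q) : Prop :=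
  f Dp.one = Dq.one ∧
    ∀ a b, Dp.le a b → Dq.le (f a) (f b) ∧ f (Dp.diff b a) = Dq.diff (f b) (f a)

/-- The D-poset `Dp` corresponds to the effect algebra `A`: same constants, same
order, and the same difference operation on its domain. -/
def Corresponds {P : Type u} (A : EffectAlgebra P) (Dp : DPoset P) : Prop :=
  Dp.zero = A.zero ∧ Dp.one = A.one ∧
  (∀ a b : P, Dp.le a b ↔ A.le a b) ∧
  (∀ a b : P, A.le a b → Dp.diff b a = A.sub b a)

namespace EffectAlgebra

/-- Relational sum. -/
def S {E : Type u} (A : EffectAlgebra E) (a b c : E) : Prop := A.D a b ∧ A.add a b = c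

theorem S.comm {E : Type u} {A : EffectAlgebra E} {a b c : E} (h : A.S a b c) : A.S b a c :=
  ⟨A.D_comm h.1, by rw [← A.add_comm h.1]; exact h.2⟩

theorem S.assoc {E : Type u} {A : EffectAlgebra E} {a b c x y : E} (h : A.S a b x)
    (k : A.S x c y) : ∃ z, A.S b c z ∧ A.S a z y := by
  obtain ⟨h1, rfl⟩ := h
  obtain ⟨k1, rfl⟩ := k
  exact ⟨_, ⟨A.D_of_assoc h1 k1, rfl⟩, A.D_assoc h1 k1, (A.add_assoc h1 k1).symm⟩

theorem S.det {E : Type u} {A : EffectAlgebra E} {a b c d : E} (h : A.S a b c)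
    (k : A.S a b d) : c = d := h.2.symm.trans k.2

theorem S.cancel {E : Type u} {A : EffectAlgebra E} {a b c d : E} (h : A.S a b d)
    (k : A.S a c d) : b = c := by
  obtain ⟨e, he, -⟩ := A.orthosupplement d
  obtain ⟨z, hz, hz1⟩ := h.comm.assoc (c := e) (y := A.one) he
  obtain ⟨w, hw, hw1⟩ := k.comm.assoc (c := e) (y := A.one) he
  obtain rfl := hz.det hw
  exact (A.orthosupplement z).unique hz1.comm hw1.comm

theorem one_zero {E : Type u} (A : EffectAlgebra E) : A.S A.one A.zero A.one := by
  obtain ⟨x, hx, -⟩ := A.orthosupplement A.one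
  have : x = A.zero := A.D_one (A.D_comm hx.1)
  rw [this] at hx
  exact hx

theorem add_zero' {E : Type u} (A : EffectAlgebra E) (a : E) : A.S a A.zero a := by
  obtain ⟨b, hb, -⟩ := A.orthosupplement a
  have hb : A.S b a A.one := S.comm hb
  obtain ⟨z, hz, hz1⟩ := hb.assoc A.one_zero
  have : z = a := hz1.cancel hb
  rw [this] at hz
  exact hz

theorem S.zero {E : Type u} {A : EffectAlgebra E} {a b : E} (h : A.S a b A.zero) :
    b = A.zero := by
  obtain ⟨z, hz, -⟩ := h.assoc A.one_zero.comm
  exact A.D_one hz.1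

theorem sub_iff {E : Type u} (A : EffectAlgebra E) (a b c : E) :
    A.S a b c ↔ A.le a c ∧ A.sub c a = b := by
  have key : A.le a c → A.S a (A.sub c a) c := by
    intro h
    have h' : ∃ b, A.D a b ∧ A.add a b = c := h
    unfold sub
    rw [dif_pos h']
    exact h'.choose_spec
  constructor
  · intro h
    exact ⟨⟨b, h⟩, (key ⟨b, h⟩).cancel h⟩
  · rintro ⟨h, rfl⟩
    exact key h

theorem S.sub_eq {E : Type u} {A : EffectAlgebra E} {a b c : E} (h : A.S a b c) :
    A.sub c a = b := ((A.sub_iff a b c).1 h).2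

/-- The D-poset of an effect algebra. -/
noncomputable def toD {E : Type u} (A : EffectAlgebra E) : DPoset E where
  le := A.le
  zero := A.zero
  one := A.one
  Ddef b a := A.le a b
  diff := A.sub
  le_refl a := ⟨_, A.add_zero' a⟩
  le_antisymm := by
    rintro a b ⟨x, hx⟩ ⟨y, hy⟩
    have hx : A.S a x b := hx
    obtain ⟨z, hz, hz1⟩ := hx.assoc (c := y) (y := a) hy
    have hz0 : z = A.zero := hz1.cancel (A.add_zero' a)
    rw [hz0] at hz
    have hx0 := hz.comm.zero
    rw [hx0] at hx
    exact (A.add_zero' a).det hx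
  le_trans := by
    rintro a b c ⟨x, hx⟩ ⟨y, hy⟩
    obtain ⟨z, hz, hz1⟩ := S.assoc (A := A) hx hy
    exact ⟨z, hz1⟩
  zero_le a := ⟨a, (A.add_zero' a).comm⟩
  le_one a := (A.orthosupplement a).exists
  d1 a b := Iff.rfl
  d2a := by
    rintro a b ⟨x, hx⟩
    have hx : A.S a x b := hx
    rw [hx.sub_eq]
    exact ⟨a, hx.comm⟩
  d2b := by
    rintro a b ⟨x, hx⟩
    have hx : A.S a x b := hx
    rw [hx.sub_eq]
    exact hx.comm.sub_eq
  d3a := by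
    rintro a b c ⟨x, hx⟩ ⟨y, hy⟩
    have hx : A.S a x b := hx
    have hy : A.S b y c := hy
    obtain ⟨z, hz, hz1⟩ := hx.assoc hy
    rw [hy.sub_eq, hz1.sub_eq]
    exact ⟨x, hz.comm⟩
  d3b := by
    rintro a b c ⟨x, hx⟩ ⟨y, hy⟩
    have hx : A.S a x b := hx
    have hy : A.S b y c := hy
    obtain ⟨z, hz, hz1⟩ := hx.assoc hy
    rw [hy.sub_eq, hz1.sub_eq, hx.sub_eq]
    exact hz.comm.sub_eq

end EffectAlgebra

namespace DPoset

/-- Relational sum of a D-poset. -/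
def S {P : Type u} (X : DPoset P) (a b c : P) : Prop := X.le a c ∧ X.diff c a = b

theorem S_iff {P : Type u} (X : DPoset P) (a b c : P) :
    (X.le a (X.diff X.one b) ∧ X.diff X.one (X.diff (X.diff X.one a) b) = c) ↔ X.S a b c := by
  constructor
  · rintro ⟨h, rfl⟩
    have hb : X.le b (X.diff X.one a) := by
      have := X.d3a h (X.d2a (X.le_one b))
      rwa [X.d2b (X.le_one b)] at this
    have h1 := X.d2a hb
    have hac : X.le a (X.diff X.one (X.diff (X.diff X.one a) b)) := by
      have := X.d3a h1 (X.le_one _)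
      rwa [X.d2b (X.le_one a)] at this
    refine ⟨hac, ?_⟩
    rw [← X.d3b hac (X.le_one _), X.d2b (X.le_one _), X.d2b hb]
  · rintro ⟨h, rfl⟩
    have e := X.d3b h (X.le_one c)
    have h1 := X.d3a h (X.le_one c)
    rw [← e]
    constructor
    · have := X.d3a (X.d2a h1) (X.le_one _)
      rwa [X.d2b (X.le_one a)] at this
    · rw [X.d2b h1, X.d2b (X.le_one c)]

theorem S.comm {P : Type u} {X : DPoset P} {a b c : P} (h : X.S a b c) : X.S b a c := by
  obtain ⟨h, rfl⟩ := h
  exact ⟨X.d2a h, X.d2b h⟩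

theorem S.assoc {P : Type u} {X : DPoset P} {a b c x y : P} (h : X.S a b x)
    (k : X.S x c y) : ∃ z, X.S b c z ∧ X.S a z y := by
  obtain ⟨h, rfl⟩ := h
  obtain ⟨k, rfl⟩ := k
  exact ⟨X.diff y a, S.comm ⟨X.d3a h k, X.d3b h k⟩, X.le_trans h k, rfl⟩

theorem one_diff_one {P : Type u} (X : DPoset P) : X.diff X.one X.one = X.zero := by
  have h := X.d3a (X.zero_le (X.diff X.one X.one)) (X.le_one _)
  rw [X.d2b (X.le_one _)] at h
  have h2 := X.le_antisymm (X.le_one _) h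
  have h3 := X.d2b (X.zero_le X.one)
  rwa [h2] at h3

/-- The effect algebra of a D-poset. -/
def toE {P : Type u} (X : DPoset P) : EffectAlgebra P where
  D a b := X.le a (X.diff X.one b)
  add a b := X.diff X.one (X.diff (X.diff X.one a) b)
  zero := X.zero
  one := X.one
  D_comm h := ((X.S_iff _ _ _).2 ((X.S_iff _ _ _).1 ⟨h, rfl⟩).comm).1
  add_comm h := ((X.S_iff _ _ _).2 ((X.S_iff _ _ _).1 ⟨h, rfl⟩).comm).2.symm
  D_of_assoc h k := by
    obtain ⟨z, hz, -⟩ := ((X.S_iff _ _ _).1 ⟨h, rfl⟩).assoc ((X.S_iff _ _ _).1 ⟨k, rfl⟩)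
    exact ((X.S_iff _ _ _).2 hz).1
  D_assoc h k := by
    obtain ⟨z, hz, hz1⟩ := ((X.S_iff _ _ _).1 ⟨h, rfl⟩).assoc ((X.S_iff _ _ _).1 ⟨k, rfl⟩)
    rw [((X.S_iff _ _ _).2 hz).2]
    exact ((X.S_iff _ _ _).2 hz1).1
  add_assoc h k := by
    obtain ⟨z, hz, hz1⟩ := ((X.S_iff _ _ _).1 ⟨h, rfl⟩).assoc ((X.S_iff _ _ _).1 ⟨k, rfl⟩)
    rw [((X.S_iff _ _ _).2 hz).2]
    exact ((X.S_iff _ _ _).2 hz1).2.symm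
  orthosupplement a := by
    refine ⟨X.diff X.one a, (X.S_iff _ _ _).2 ⟨X.le_one a, rfl⟩, ?_⟩
    intro y hy
    exact ((X.S_iff _ _ _).1 hy).2.symm
  D_one h := by
    rw [X.one_diff_one] at h
    exact X.le_antisymm h (X.zero_le _)

theorem toE_S {P : Type u} (X : DPoset P) (a b c : P) : X.toE.S a b c ↔ X.S a b c :=
  X.S_iff a b c

end DPoset

theorem Corresponds.S_iff {P : Type u} {A : EffectAlgebra P} {X : DPoset P}
    (h : Corresponds A X) (a b c : P) : A.S a b c ↔ X.S a b c := by
  rw [A.sub_iff, DPoset.S, h.2.2.1]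
  constructor
  · rintro ⟨h1, h2⟩
    exact ⟨h1, (h.2.2.2 _ _ h1).trans h2⟩
  · rintro ⟨h1, h2⟩
    exact ⟨h1, (h.2.2.2 _ _ h1).symm.trans h2⟩

/-- Every effect algebra, with its induced order and difference,
is a D-poset; conversely every D-poset carries an effect algebra structure with
`a ⊕ b` defined iff `a ≤ 1 ⊖ b`, in which case `a ⊕ b = 1 ⊖ ((1 ⊖ a) ⊖ b)`, whose
difference is the original one; these constructions are mutually inverse, and a map
is a morphism of effect algebras iff it is a morphism of the corresponding D-posets:
the categories of D-posets and of effect algebras are isomorphic. -/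
theorem dposets_isomorphic_to_effect_algebras :
    (∀ (P : Type u) (A : EffectAlgebra P), ∃ Dp : DPoset P, Corresponds A Dp) ∧
    (∀ (P : Type u) (Dp : DPoset P), ∃ A : EffectAlgebra P, Corresponds A Dp ∧
       (∀ a b : P, A.D a b ↔ Dp.le a (Dp.diff Dp.one b)) ∧
       (∀ a b : P, A.D a b →
          A.add a b = Dp.diff Dp.one (Dp.diff (Dp.diff Dp.one a) b))) ∧
    (∀ (P : Type u) (Q : Type v) (A : EffectAlgebra P) (B : EffectAlgebra Q)
       (Dp : DPoset P) (Dq : DPoset Q), Corresponds A Dp → Corresponds B Dq →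
        ∀ f : P → Q, A.Hom B f ↔ Dp.Hom Dq f) := by
  refine ⟨fun P A => ⟨A.toD, rfl, rfl, fun _ _ => Iff.rfl, fun _ _ _ => rfl⟩,
    fun P X => ⟨X.toE, ⟨rfl, rfl, ?_, ?_⟩, fun _ _ => Iff.rfl, fun _ _ _ => rfl⟩, ?_⟩
  · intro a b
    constructor
    · intro h
      exact ⟨_, (X.toE_S _ _ _).2 ⟨h, rfl⟩⟩
    · rintro ⟨c, hc⟩
      exact ((X.toE_S _ _ _).1 hc).1
  · rintro a b ⟨c, hc⟩
    have hc : X.toE.S a c b := hc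
    rw [hc.sub_eq]
    exact ((X.toE_S _ _ _).1 hc).2
  · intro P Q A B X Y hX hY f
    unfold EffectAlgebra.Hom DPoset.Hom
    rw [hX.2.1, hY.2.1]
    refine and_congr_right fun _ => ⟨fun H a b h => ?_, fun H a b h => ?_⟩
    · obtain ⟨h1, h2⟩ := (hX.S_iff a _ b).2 ⟨h, rfl⟩
      obtain ⟨k1, k2⟩ := H _ _ h1
      rw [h2] at k2
      obtain ⟨l1, l2⟩ := (hY.S_iff _ _ _).1 ⟨k1, k2.symm⟩
      exact ⟨l1, l2.symm⟩
    · obtain ⟨h1, h2⟩ := (hX.S_iff a b _).1 ⟨h, rfl⟩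
      obtain ⟨k1, k2⟩ := H _ _ h1
      rw [h2] at k2
      obtain ⟨l1, l2⟩ := (hY.S_iff _ _ _).2 ⟨k1, k2.symm⟩
      exact ⟨l1, l2.symm⟩
end

section
/- For every effect algebra A, the map m_A : K(A) → A defined on even-length chains by m_A([x₁<x₂<…<x_{2n-1}<x_{2n}]) = (x₂⊖x₁)⊕(x₄⊖x₃)⊕…⊕(x_{2n}⊖x_{2n-1}) (and m_A(∅)=0) is well defined (all indicated sums exist) and makes (U(A), m_A) an Eilenberg-Moore algebra for the Kalmbach monad: m_A∘η_{U(A)} = id and m_A∘T(m_A) = m_A∘μ_{U(A)}. -/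
attribute [local instance] Classical.propDecidable

universe u v w

section Helpers

theorem kh_ite_odd (n : ℕ) : (if Odd n then (1 : ZMod 2) else 0) = (n : ZMod 2) := by
  split_ifs with h
  · exact ((ZMod.natCast_eq_one_iff_odd).2 h).symm
  · exact ((ZMod.natCast_eq_zero_iff_even).2 (Nat.not_odd_iff_even.1 h)).symm

theorem kh_map_parity {α : Type u} {β : Type v} (f : α → β) (C : Finset α) (Q : β → Prop)
    [DecidablePred Q] :
    Odd ((kalMapF f C).filter Q).card ↔ Odd (C.filter fun x => Q (f x)).card := by
  rw [← ZMod.natCast_eq_one_iff_odd, ← ZMod.natCast_eq_one_iff_odd]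
  suffices h : ((((kalMapF f C).filter Q).card : ℕ) : ZMod 2)
      = ((C.filter fun x => Q (f x)).card : ℕ) by rw [h]
  rw [Finset.natCast_card_filter, Finset.natCast_card_filter]
  unfold kalMapF
  rw [Finset.sum_filter]
  rw [← Finset.sum_fiberwise_of_maps_to (s := C) (t := C.image f) (g := f)
    (fun x hx => Finset.mem_image_of_mem f hx)]
  refine Finset.sum_congr rfl fun y _ => ?_
  have : ∀ x ∈ C.filter (fun x => f x = y), (if Q (f x) then (1 : ZMod 2) else 0)
      = if Q y then 1 else 0 := by
    intro x hx
    rw [(Finset.mem_filter.1 hx).2]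
  rw [Finset.sum_congr rfl this, Finset.sum_const, nsmul_eq_mul, ← kh_ite_odd]
  split_ifs <;> simp

theorem kh_mu_parity {α : Type u} (𝒞 : Finset (Finset α)) (Q : α → Prop) [DecidablePred Q] :
    Odd ((kalMuF 𝒞).filter Q).card ↔
      Odd (𝒞.filter fun C => Odd (C.filter Q).card).card := by
  rw [← ZMod.natCast_eq_one_iff_odd, ← ZMod.natCast_eq_one_iff_odd]
  suffices h : ((((kalMuF 𝒞).filter Q).card : ℕ) : ZMod 2)
      = ((𝒞.filter fun C => Odd (C.filter Q).card).card : ℕ) by rw [h]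
  rw [Finset.natCast_card_filter, Finset.natCast_card_filter]
  unfold kalMuF
  rw [Finset.sum_filter]
  have h1 : ∀ x ∈ 𝒞.sup id, (if Odd (𝒞.filter fun C => x ∈ C).card then
      (if Q x then (1 : ZMod 2) else 0) else 0)
      = ∑ C ∈ 𝒞, if x ∈ C then (if Q x then (1 : ZMod 2) else 0) else 0 := by
    intro x _
    rw [← Finset.sum_filter, Finset.sum_const, nsmul_eq_mul, ← kh_ite_odd]
    split_ifs <;> simp
  rw [Finset.sum_congr rfl h1, Finset.sum_comm]
  refine Finset.sum_congr rfl fun C hC => ?_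
  rw [kh_ite_odd, Finset.natCast_card_filter, ← Finset.sum_filter]
  refine Finset.sum_congr ?_ fun _ _ => rfl
  ext x
  simp only [Finset.mem_filter, Finset.mem_sup, id]
  exact ⟨fun h => h.2, fun h => ⟨⟨C, hC, h⟩, h⟩⟩

theorem kh_sort {α : Type u} (r : α → α → Prop) (l : List α)
    (tot : ∀ a ∈ l, ∀ b ∈ l, r a b ∨ r b a)
    (tr : ∀ a ∈ l, ∀ b ∈ l, ∀ c ∈ l, r a b → r b c → r a c) :
    (l.mergeSort fun a b => decide (r a b)).Pairwise r := by
  have h := List.pairwise_mergeSort (le := fun a b : {x // x ∈ l} => decide (r a.1 b.1))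
    (by intro a b c; simpa using tr a.1 a.2 b.1 b.2 c.1 c.2)
    (by intro a b; simpa using tot a.1 a.2 b.1 b.2) l.attach
  have e := List.map_mergeSort (r := fun a b : {x // x ∈ l} => decide (r a.1 b.1))
    (s := fun a b => decide (r a b)) (f := Subtype.val) (l := l.attach) (by intros; rfl)
  rw [List.attach_map_subtype_val] at e
  rw [← e, List.pairwise_map]
  exact h.imp (by intro a b hab; simpa using hab)

theorem kh_count {α : Type u} (C : Finset α) (l : List α) (h : l.Perm C.toList) (Q : α → Prop)
    [DecidablePred Q] (p : α → Bool) (hp : ∀ x, p x = true ↔ Q x) :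
    l.countP p = (C.filter Q).card := by
  have e : p = fun x => decide (Q x) := by
    funext x
    rw [Bool.eq_iff_iff, hp]; simp
  subst e
  rw [h.countP_eq, ← Multiset.coe_countP, Finset.coe_toList, Multiset.countP_eq_card_filter]
  rw [Finset.card_def, Finset.filter_val]

/-- pairs of an even chain, cut by a down-closed predicate -/
theorem kh_pairAt {P : Type u} [PartialOrder P] (C : Finset P)
    (hC : IsEvenChainR (· ≤ ·) C) (Q : P → Prop) (hQ : ∀ a b, a ≤ b → Q b → Q a)
    (ho : Odd (C.filter Q).card) :
    ∃ a b, KalPairR (· ≤ ·) C a b ∧ Q a ∧ ¬ Q b := by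
  obtain ⟨htot, hev⟩ := hC
  have hne : (C.filter Q).Nonempty := by
    rw [← Finset.card_pos]; exact ho.pos
  have hne2 : (C.filter fun x => ¬ Q x).Nonempty := by
    rw [Finset.nonempty_iff_ne_empty]
    intro h
    have := Finset.card_filter_add_card_filter_not (s := C) Q
    rw [h] at this
    simp only [Finset.card_empty, add_zero] at this
    rw [this] at ho
    exact (Nat.not_odd_iff_even.2 hev) ho
  obtain ⟨a, ha⟩ := Finset.exists_maximal hne
  obtain ⟨b, hb⟩ := Finset.exists_minimal hne2
  have ha1 := Finset.mem_filter.1 ha.1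
  have hb1 := Finset.mem_filter.1 hb.1
  have hamax : ∀ c ∈ C, Q c → c ≤ a := by
    intro c hc hq
    rcases htot c hc a ha1.1 with h | h
    · exact h
    · exact ha.2 (Finset.mem_filter.2 ⟨hc, hq⟩) h
  have hbmin : ∀ c ∈ C, ¬ Q c → b ≤ c := by
    intro c hc hq
    rcases htot b hb1.1 c hc with h | h
    · exact h
    · exact hb.2 (Finset.mem_filter.2 ⟨hc, hq⟩) h
  refine ⟨a, b, ⟨ha1.1, hb1.1, ?_, ?_, ?_, ?_⟩, ha1.2, hb1.2⟩
  · rcases htot a ha1.1 b hb1.1 with h | h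
    · exact h
    · exact absurd (hQ _ _ h ha1.2) hb1.2
  · rintro rfl; exact hb1.2 ha1.2
  · have : C.filter (fun y => y ≤ a) = C.filter Q := by
      ext y
      simp only [Finset.mem_filter]
      exact ⟨fun h => ⟨h.1, hQ _ _ h.2 ha1.2⟩, fun h => ⟨h.1, hamax y h.1 h.2⟩⟩
    convert ho
  · intro c hc hac hne
    refine hbmin c hc fun hq => hne (le_antisymm (hamax c hc hq) hac)

theorem kh_not_odd {α : Type u} (C : Finset α) (hev : Even C.card) (Q : α → Prop) :
    Odd (C.filter fun x => ¬ Q x).card ↔ Odd (C.filter Q).card := by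
  have := Finset.card_filter_add_card_filter_not (s := C) Q
  rw [← this] at hev
  have h2 := Nat.even_add.1 hev
  rw [← Nat.not_even_iff_odd, ← Nat.not_even_iff_odd, h2]

theorem kh_le_odd {P : Type u} [PartialOrder P] (C D : Finset P)
    (hC : IsEvenChainR (· ≤ ·) C) (hD : IsEvenChainR (· ≤ ·) D)
    (h : KalLER (· ≤ ·) C D) (p : P)
    (ho : Odd (C.filter fun x => ¬ x ≤ p).card) : Odd (D.filter fun x => ¬ x ≤ p).card := by
  rw [kh_not_odd C hC.2] at ho
  rw [kh_not_odd D hD.2]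
  obtain ⟨a, b, hab, ha, hb⟩ := kh_pairAt C hC (fun x => x ≤ p) (fun _ _ h1 h2 => h1.trans h2) ho
  obtain ⟨c, d, hcd, hca, hbd⟩ := h a b hab
  obtain ⟨hc, hd, -, -, hodd, hs⟩ := hcd
  have : D.filter (fun y => y ≤ p) = D.filter (fun y => y ≤ c) := by
    ext y
    simp only [Finset.mem_filter]
    refine ⟨fun hy => ⟨hy.1, ?_⟩, fun hy => ⟨hy.1, hy.2.trans (hca.trans ha)⟩⟩
    rcases hD.1 y hy.1 c hc with h1 | h1
    · exact h1
    · by_contra hne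
      exact hb (hbd.trans ((hs y hy.1 h1 (fun e => hne e.le)).trans hy.2))
  rw [this]
  exact hodd

theorem kh_mem_pair {P : Type u} [PartialOrder P] (C : Finset P)
    (hC : IsEvenChainR (· ≤ ·) C) (x : P) (hx : x ∈ C) :
    ∃ a b, KalPairR (· ≤ ·) C a b ∧ a ≤ x ∧ x ≤ b := by
  by_cases ho : Odd (C.filter fun y => y ≤ x).card
  · obtain ⟨a, b, hab, ha, hb⟩ :=
      kh_pairAt C hC (fun y => y ≤ x) (fun _ _ h1 h2 => h1.trans h2) ho
    refine ⟨a, b, hab, ha, ?_⟩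
    rcases hC.1 x hx b hab.2.1 with h | h
    · exact h
    · exact absurd h hb
  · have h2 : Odd (C.filter fun y => y < x).card := by
      have e : C.filter (fun y => y ≤ x) = insert x (C.filter fun y => y < x) := by
        ext y
        simp only [Finset.mem_filter, Finset.mem_insert, le_iff_lt_or_eq]
        constructor
        · rintro ⟨h1, h2 | h2⟩
          · exact Or.inr ⟨h1, h2⟩
          · exact Or.inl h2
        · rintro (h | h)
          · exact ⟨h ▸ hx, Or.inr h⟩
          · exact ⟨h.1, Or.inl h.2⟩
      rw [e, Finset.card_insert_of_notMem (by simp)] at ho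
      by_contra h3
      exact ho (Nat.not_odd_iff_even.1 h3).add_one
    obtain ⟨a, b, hab, ha, hb⟩ :=
      kh_pairAt C hC (fun y => y < x) (fun _ _ h1 h2 => h1.trans_lt h2) h2
    refine ⟨a, b, hab, ha.le, ?_⟩
    rcases hC.1 x hx b hab.2.1 with h | h
    · exact h
    · by_contra hne
      exact hb (lt_of_le_of_ne h (fun e => hne e.ge))

theorem kh_comparable {P : Type u} [PartialOrder P] (C D : Finset P)
    (hC : IsEvenChainR (· ≤ ·) C) (hD : IsEvenChainR (· ≤ ·) D)
    (h : KalLER (· ≤ ·) C D) (x y : P) (hx : x ∈ C) (hy : y ∈ D) : x ≤ y ∨ y ≤ x := by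
  obtain ⟨a, b, hab, ha, hb⟩ := kh_mem_pair C hC x hx
  obtain ⟨c, d, ⟨hc, hd, -, -, -, hs⟩, hca, hbd⟩ := h a b hab
  by_cases hyc : y ≤ c
  · exact Or.inr (hyc.trans (hca.trans ha))
  · rcases hD.1 y hy c hc with h1 | h1
    · exact absurd h1 hyc
    · exact Or.inl (hb.trans (hbd.trans (hs y hy h1 (fun e => hyc e.le))))

/-! ### the total commutative monoid of an effect algebra -/

theorem kh_zero {P : Type u} (A : EffectAlgebra P) (a : P) :
    A.D a A.zero ∧ A.add a A.zero = a := by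
  obtain ⟨o, ⟨ho1, ho2⟩, -⟩ := A.orthosupplement A.one
  have ho : o = A.zero := A.D_one (A.D_comm ho1)
  subst ho
  obtain ⟨x, ⟨hx1, hx2⟩, -⟩ := A.orthosupplement a
  have hxa := A.D_comm hx1
  have hxa2 : A.add x a = A.one := by rw [A.add_comm hxa, hx2]
  rw [← hxa2] at ho1
  have e := A.add_assoc hxa ho1
  refine ⟨A.D_of_assoc hxa ho1, ?_⟩
  refine (A.orthosupplement x).unique ⟨A.D_assoc hxa ho1, ?_⟩ ⟨hxa, hxa2⟩
  rw [← e, hxa2, ho2]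

/-- `P` with an additional absorbing "undefined" element. -/
def EAMon {P : Type u} (_ : EffectAlgebra P) : Type u := Option P

def EAMon.mk {P : Type u} (A : EffectAlgebra P) (a : P) : EAMon A := some a

def EAMon.bad {P : Type u} (A : EffectAlgebra P) : EAMon A := none

noncomputable def EAMon.plus {P : Type u} (A : EffectAlgebra P) : EAMon A → EAMon A → EAMon A
  | some a, some b => if A.D a b then EAMon.mk A (A.add a b) else EAMon.bad A
  | _, _ => EAMon.bad A

theorem kh_plus_mk {P : Type u} (A : EffectAlgebra P) (a b : P) :
    EAMon.plus A (EAMon.mk A a) (EAMon.mk A b)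
      = if A.D a b then EAMon.mk A (A.add a b) else EAMon.bad A := rfl

theorem kh_bad_plus {P : Type u} (A : EffectAlgebra P) (x : EAMon A) :
    EAMon.plus A (EAMon.bad A) x = EAMon.bad A := by
  cases x <;> rfl

theorem kh_plus_bad {P : Type u} (A : EffectAlgebra P) (x : EAMon A) :
    EAMon.plus A x (EAMon.bad A) = EAMon.bad A := by
  cases x <;> rfl

theorem kh_mk_ne_bad {P : Type u} (A : EffectAlgebra P) (a : P) :
    EAMon.mk A a ≠ EAMon.bad A := by
  intro h; cases h

theorem kh_mk_inj {P : Type u} (A : EffectAlgebra P) {a b : P}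
    (h : EAMon.mk A a = EAMon.mk A b) : a = b := Option.some.inj h

theorem kh_cases {P : Type u} {A : EffectAlgebra P} (x : EAMon A) :
    x = EAMon.bad A ∨ ∃ a, x = EAMon.mk A a := by
  cases x with
  | none => exact Or.inl rfl
  | some a => exact Or.inr ⟨a, rfl⟩

theorem kh_plus_comm {P : Type u} (A : EffectAlgebra P) (x y : EAMon A) :
    EAMon.plus A x y = EAMon.plus A y x := by
  rcases kh_cases x with rfl | ⟨a, rfl⟩
  · rw [kh_bad_plus, kh_plus_bad]
  rcases kh_cases y with rfl | ⟨b, rfl⟩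
  · rw [kh_bad_plus, kh_plus_bad]
  rw [kh_plus_mk, kh_plus_mk]
  by_cases h : A.D a b
  · rw [if_pos h, if_pos (A.D_comm h), A.add_comm h]
  · rw [if_neg h, if_neg (fun h' => h (A.D_comm h'))]

theorem kh_plus_assoc_aux {P : Type u} (A : EffectAlgebra P) (x y z : EAMon A)
    (h : EAMon.plus A (EAMon.plus A x y) z ≠ EAMon.bad A) :
    EAMon.plus A (EAMon.plus A x y) z = EAMon.plus A x (EAMon.plus A y z) := by
  rcases kh_cases x with rfl | ⟨a, rfl⟩
  · simp [kh_bad_plus] at h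
  rcases kh_cases y with rfl | ⟨b, rfl⟩
  · simp [kh_bad_plus, kh_plus_bad] at h
  rcases kh_cases z with rfl | ⟨c, rfl⟩
  · simp [kh_plus_bad] at h
  rw [kh_plus_mk] at h ⊢
  by_cases h1 : A.D a b
  · rw [if_pos h1, kh_plus_mk] at h ⊢
    by_cases h2 : A.D (A.add a b) c
    · rw [if_pos h2, kh_plus_mk, if_pos (A.D_of_assoc h1 h2), kh_plus_mk,
        if_pos (A.D_assoc h1 h2), A.add_assoc h1 h2]
    · rw [if_neg h2] at h; exact absurd rfl h
  · rw [if_neg h1, kh_bad_plus] at h; exact absurd rfl h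

theorem kh_plus_assoc {P : Type u} (A : EffectAlgebra P) (x y z : EAMon A) :
    EAMon.plus A (EAMon.plus A x y) z = EAMon.plus A x (EAMon.plus A y z) := by
  by_cases h : EAMon.plus A (EAMon.plus A x y) z = EAMon.bad A
  · by_contra hne
    have h2 : EAMon.plus A (EAMon.plus A z y) x ≠ EAMon.bad A := by
      rw [kh_plus_comm A _ x, kh_plus_comm A z y]
      intro h3; exact hne (h.trans h3.symm)
    have h3 := kh_plus_assoc_aux A z y x h2
    apply hne
    rw [kh_plus_comm A x (EAMon.plus A y z), kh_plus_comm A y z, h3,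
      kh_plus_comm A z (EAMon.plus A y x), kh_plus_comm A y x]
  · exact kh_plus_assoc_aux A x y z h

noncomputable instance {P : Type u} (A : EffectAlgebra P) : Zero (EAMon A) :=
  ⟨EAMon.mk A A.zero⟩

noncomputable instance {P : Type u} (A : EffectAlgebra P) : Add (EAMon A) :=
  ⟨EAMon.plus A⟩

noncomputable instance {P : Type u} (A : EffectAlgebra P) : AddCommMonoid (EAMon A) where
  add_assoc := kh_plus_assoc A
  add_comm := kh_plus_comm A
  zero_add := by
    intro x
    change EAMon.plus A (EAMon.mk A A.zero) x = x
    rcases kh_cases x with rfl | ⟨a, rfl⟩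
    · exact kh_plus_bad A _
    · rw [kh_plus_comm, kh_plus_mk, if_pos (kh_zero A a).1, (kh_zero A a).2]
  add_zero := by
    intro x
    change EAMon.plus A x (EAMon.mk A A.zero) = x
    rcases kh_cases x with rfl | ⟨a, rfl⟩
    · exact kh_bad_plus A _
    · rw [kh_plus_mk, if_pos (kh_zero A a).1, (kh_zero A a).2]
  nsmul := nsmulRec

theorem kh_mk_zero {P : Type u} (A : EffectAlgebra P) : EAMon.mk A A.zero = 0 := rfl

theorem kh_add_mk {P : Type u} (A : EffectAlgebra P) {a b : P} (h : A.D a b) :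
    EAMon.mk A a + EAMon.mk A b = EAMon.mk A (A.add a b) := by
  change EAMon.plus A _ _ = _
  rw [kh_plus_mk, if_pos h]

theorem kh_add_D {P : Type u} (A : EffectAlgebra P) {a b : P}
    (h : EAMon.mk A a + EAMon.mk A b ≠ EAMon.bad A) : A.D a b := by
  by_contra hD
  apply h
  change EAMon.plus A _ _ = _
  rw [kh_plus_mk, if_neg hD]

theorem kh_bad_add {P : Type u} (A : EffectAlgebra P) (x : EAMon A) :
    EAMon.bad A + x = EAMon.bad A := kh_bad_plus A x

theorem kh_left_ne {P : Type u} {A : EffectAlgebra P} {x y : EAMon A}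
    (h : x + y ≠ EAMon.bad A) : x ≠ EAMon.bad A := by
  rintro rfl; exact h (kh_bad_add A y)

theorem kh_right_ne {P : Type u} {A : EffectAlgebra P} {x y : EAMon A}
    (h : x + y ≠ EAMon.bad A) : y ≠ EAMon.bad A := by
  rw [add_comm] at h; exact kh_left_ne h

theorem kh_one_unique {P : Type u} (A : EffectAlgebra P) (x y z : EAMon A)
    (h1 : x + y = EAMon.mk A A.one) (h2 : x + z = EAMon.mk A A.one) : y = z := by
  have n1 : x + y ≠ EAMon.bad A := by rw [h1]; exact kh_mk_ne_bad A _
  have n2 : x + z ≠ EAMon.bad A := by rw [h2]; exact kh_mk_ne_bad A _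
  obtain ⟨a, rfl⟩ := (kh_cases x).resolve_left (kh_left_ne n1)
  obtain ⟨b, rfl⟩ := (kh_cases y).resolve_left (kh_right_ne n1)
  obtain ⟨c, rfl⟩ := (kh_cases z).resolve_left (kh_right_ne n2)
  have d1 := kh_add_D A n1
  have d2 := kh_add_D A n2
  rw [kh_add_mk A d1] at h1
  rw [kh_add_mk A d2] at h2
  rw [(A.orthosupplement a).unique ⟨d1, kh_mk_inj A h1⟩ ⟨d2, kh_mk_inj A h2⟩]

theorem kh_cancel {P : Type u} (A : EffectAlgebra P) (x y z : EAMon A)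
    (h : x + y = x + z) (hn : x + y ≠ EAMon.bad A) : y = z := by
  obtain ⟨s, hs⟩ := (kh_cases (x + y)).resolve_left hn
  obtain ⟨e, ⟨he1, he2⟩, -⟩ := A.orthosupplement s
  have h1 : x + y + EAMon.mk A e = EAMon.mk A A.one := by
    rw [hs, kh_add_mk A he1, he2]
  have h2 : x + z + EAMon.mk A e = EAMon.mk A A.one := by rw [← h, h1]
  refine kh_one_unique A (x + EAMon.mk A e) y z ?_ ?_
  · rw [← h1]; abel
  · rw [← h2]; abel

theorem kh_sub {P : Type u} (A : EffectAlgebra P) {a b : P} (h : A.le a b) :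
    EAMon.mk A a + EAMon.mk A (A.sub b a) = EAMon.mk A b := by
  have h' : ∃ c, A.D a c ∧ A.add a c = b := h
  have e : A.sub b a = h'.choose := by unfold EffectAlgebra.sub; rw [dif_pos h']
  rw [e, kh_add_mk A h'.choose_spec.1, h'.choose_spec.2]

theorem kh_le_iff {P : Type u} (A : EffectAlgebra P) {a b : P} (x : EAMon A)
    (h : EAMon.mk A a + x = EAMon.mk A b) : A.le a b ∧ EAMon.mk A (A.sub b a) = x := by
  have n : EAMon.mk A a + x ≠ EAMon.bad A := by rw [h]; exact kh_mk_ne_bad A _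
  obtain ⟨c, rfl⟩ := (kh_cases x).resolve_left (kh_right_ne n)
  have d := kh_add_D A n
  have hl : A.le a b := ⟨c, d, by rw [kh_add_mk A d] at h; exact kh_mk_inj A h⟩
  refine ⟨hl, ?_⟩
  have hs := kh_sub A hl
  refine kh_cancel A (EAMon.mk A a) _ _ (hs.trans h.symm) ?_
  rw [hs]; exact kh_mk_ne_bad A _

theorem kh_subset_ne {P : Type u} (A : EffectAlgebra P) (f : ℕ → EAMon A) {S T : Finset ℕ}
    (h : S ⊆ T) (hT : ∑ k ∈ T, f k ≠ EAMon.bad A) : ∑ k ∈ S, f k ≠ EAMon.bad A := by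
  rw [← Finset.sum_sdiff h] at hT
  exact kh_right_ne hT

theorem kh_subset_le {P : Type u} (A : EffectAlgebra P) (f : ℕ → EAMon A) {S T : Finset ℕ}
    (h : S ⊆ T) {a b : P} (ha : EAMon.mk A a = ∑ k ∈ S, f k)
    (hb : EAMon.mk A b = ∑ k ∈ T, f k) :
    A.le a b ∧ EAMon.mk A (A.sub b a) = ∑ k ∈ T \ S, f k := by
  apply kh_le_iff
  rw [ha, hb, add_comm, Finset.sum_sdiff h]

/-- the key computation -/
theorem kh_key {P : Type u} (A : EffectAlgebra P) (N : ℕ) (f : ℕ → EAMon A)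
    (hN : ∑ k ∈ Finset.range N, f k ≠ EAMon.bad A) {ι : Type v} (x : ι → P)
    (T : ι → Finset ℕ) : ∀ n (l : List ι), l.length = 2 * n →
    l.Pairwise (fun i j => T i ⊆ T j) →
    (∀ i ∈ l, T i ⊆ Finset.range N) → (∀ i ∈ l, EAMon.mk A (x i) = ∑ k ∈ T i, f k) →
    eaSumListDefined A (l.map x) ∧
    EAMon.mk A (eaSumList A (l.map x)) =
      ∑ k ∈ (Finset.range N).filter (fun k => Odd (l.countP fun i => decide (k ∈ T i))), f k := by
  intro n
  induction n with
  | zero =>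
    intro l hl _ _ _
    obtain rfl := List.length_eq_zero_iff.1 (by simpa using hl)
    simp [eaSumList, eaSumListDefined, kh_mk_zero]
  | succ n ih =>
    intro l hl hp hr hx
    match l, hl with
    | a :: b :: l, hl =>
      have hl' : l.length = 2 * n := by simp at hl; omega
      rw [List.pairwise_cons, List.pairwise_cons] at hp
      obtain ⟨hpa, hpb, hpl⟩ := hp
      obtain ⟨ih1, ih2⟩ := ih l hl' hpl (fun i hi => hr i (by simp [hi]))
        (fun i hi => hx i (by simp [hi]))
      obtain ⟨hle, hsub⟩ := kh_subset_le A f (hpa b (by simp)) (hx a (by simp)) (hx b (by simp))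
      set S := (Finset.range N).filter (fun k => Odd (l.countP fun i => decide (k ∈ T i)))
        with hS
      have hdisj : Disjoint (T b \ T a) S := by
        rw [Finset.disjoint_left]
        intro k hk hk2
        have hkb := (Finset.mem_sdiff.1 hk).1
        have : l.countP (fun i => decide (k ∈ T i)) = l.length := by
          rw [List.countP_eq_length]
          intro i hi
          simpa using hpb i hi hkb
        have h3 := (Finset.mem_filter.1 hk2).2
        rw [this, hl'] at h3
        exact (Nat.not_odd_iff_even.2 (even_two_mul n)) h3
      have hunion : (Finset.range N).filter
          (fun k => Odd ((a :: b :: l).countP fun i => decide (k ∈ T i))) = (T b \ T a) ∪ S := by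
        ext k
        simp only [hS, Finset.mem_filter, Finset.mem_union, Finset.mem_sdiff, List.countP_cons]
        have hb' : k ∈ T b → k ∈ Finset.range N := fun h => hr b (by simp) h
        have hab : k ∈ T a → k ∈ T b := fun h => hpa b (by simp) h
        have hbl : k ∈ T b → ¬ Odd (l.countP (fun i => decide (k ∈ T i))) := by
          intro h h3
          exact (Finset.disjoint_left.1 hdisj) (a := k) (by
            by_contra hka
            have hka : k ∈ T a := by
              by_contra h5; exact hka (Finset.mem_sdiff.2 ⟨h, h5⟩)
            have : l.countP (fun i => decide (k ∈ T i)) = l.length := by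
              rw [List.countP_eq_length]
              intro i hi
              simpa using hpb i hi h
            rw [this, hl'] at h3
            exact (Nat.not_odd_iff_even.2 (even_two_mul n)) h3)
            (Finset.mem_filter.2 ⟨hb' h, h3⟩)
        by_cases h1 : k ∈ T b
        · have hev := Nat.not_odd_iff_even.1 (hbl h1)
          by_cases h2 : k ∈ T a
          · simp [h1, h2, hb' h1, Nat.odd_add_one]
          · simp [h1, h2, hev, Finset.mem_range.1 (hb' h1)]
        · have h2 : k ∉ T a := fun h => h1 (hab h)
          simp [h1, h2]
      have hsub' : EAMon.mk A (A.sub (x b) (x a)) + EAMon.mk A (eaSumList A (l.map x))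
          = ∑ k ∈ (T b \ T a) ∪ S, f k := by
        rw [hsub, ih2, Finset.sum_union hdisj]
      have hne : EAMon.mk A (A.sub (x b) (x a)) + EAMon.mk A (eaSumList A (l.map x))
          ≠ EAMon.bad A := by
        rw [hsub', ← hunion]
        exact kh_subset_ne A f (Finset.filter_subset _ _) hN
      have hD := kh_add_D A hne
      refine ⟨⟨hle, hD, ih1⟩, ?_⟩
      rw [hunion, ← hsub', kh_add_mk A hD]
      rfl

theorem kh_grid {P : Type u} [PartialOrder P] [BoundedOrder P]
    (A : EffectAlgebra P) (h0 : A.zero = ⊥) (hle : ∀ a b : P, A.le a b ↔ a ≤ b)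
    (L : Finset P) (hL : ∀ a ∈ L, ∀ b ∈ L, a ≤ b ∨ b ≤ a) :
    ∃ (N : ℕ) (f : ℕ → EAMon A) (q : ℕ → P),
      ∑ k ∈ Finset.range N, f k ≠ EAMon.bad A ∧
      ∀ x ∈ L, EAMon.mk A x = ∑ k ∈ (Finset.range N).filter (fun k => ¬ x ≤ q k), f k := by
  set l := L.toList.mergeSort fun a b => decide (a ≤ b) with hl
  have hs : l.Pairwise (· ≤ ·) := kh_sort (· ≤ ·) L.toList (by simpa using hL)
    (fun a _ b _ c _ => le_trans)
  have hmem : ∀ x, x ∈ l ↔ x ∈ L := by intro x; simp [hl]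
  set l2 := (⊥ : P) :: l with hl2
  have hs2 : l2.Pairwise (· ≤ ·) := List.pairwise_cons.2 ⟨fun _ _ => bot_le, hs⟩
  set q : ℕ → P := fun k => l2.getD k ⊤ with hq
  have hq0 : q 0 = ⊥ := by simp [hq, hl2]
  have hmono : Monotone q := by
    intro i j hij
    by_cases hj : j < l2.length
    · have hi : i < l2.length := lt_of_le_of_lt hij hj
      simp only [hq, List.getD_eq_getElem _ _ hi, List.getD_eq_getElem _ _ hj]
      rcases hij.eq_or_lt with rfl | h
      · exact le_rfl
      · exact List.pairwise_iff_getElem.1 hs2 i j hi hj h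
    · have : q j = ⊤ := by simp only [hq]; rw [List.getD_eq_default _ _ (not_lt.1 hj)]
      rw [this]; exact le_top
  have hsum : ∀ j, ∑ k ∈ Finset.range j, EAMon.mk A (A.sub (q (k + 1)) (q k))
      = EAMon.mk A (q j) := by
    intro j
    induction j with
    | zero => simp [hq0, ← h0, kh_mk_zero]
    | succ j ih =>
      rw [Finset.sum_range_succ, ih]
      exact kh_sub A ((hle _ _).2 (hmono (Nat.le_succ j)))
  refine ⟨l2.length, fun k => EAMon.mk A (A.sub (q (k + 1)) (q k)), q, ?_, ?_⟩
  · rw [hsum]; exact kh_mk_ne_bad A _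
  · intro x hx
    have hx2 : x ∈ l2 := List.mem_cons_of_mem _ ((hmem x).2 hx)
    have hex : ∃ i, q i = x := by
      obtain ⟨i, hi, rfl⟩ := List.getElem_of_mem hx2
      exact ⟨i, by simp only [hq]; rw [List.getD_eq_getElem _ _ hi]⟩
    have hexN : ∃ i, i < l2.length ∧ q i = x := by
      obtain ⟨i, hi, rfl⟩ := List.getElem_of_mem hx2
      exact ⟨i, hi, by simp only [hq]; rw [List.getD_eq_getElem _ _ hi]⟩
    obtain ⟨j, hj, hjx⟩ := hexN
    have hi := Nat.find_spec hex
    have hij : Nat.find hex ≤ j := Nat.find_min' hex hjx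
    have : (Finset.range l2.length).filter (fun k => ¬ x ≤ q k)
        = Finset.range (Nat.find hex) := by
      ext k
      simp only [Finset.mem_filter, Finset.mem_range]
      constructor
      · rintro ⟨_, h⟩
        by_contra hk
        apply h
        rw [← hi]
        exact hmono (not_lt.1 hk)
      · intro hk
        refine ⟨by omega, fun h => ?_⟩
        refine Nat.find_min hex hk (le_antisymm ?_ h)
        rw [← hi]
        exact hmono hk.le
    rw [this, hsum, hi]

theorem kh_chain {P : Type u} [PartialOrder P]
    (A : EffectAlgebra P) (hle : ∀ a b : P, A.le a b ↔ a ≤ b)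
    (N : ℕ) (f : ℕ → EAMon A) (q : ℕ → P)
    (hN : ∑ k ∈ Finset.range N, f k ≠ EAMon.bad A) (C : Finset P)
    (hC : IsEvenChainR (· ≤ ·) C)
    (hx : ∀ x ∈ C, EAMon.mk A x = ∑ k ∈ (Finset.range N).filter (fun k => ¬ x ≤ q k), f k) :
    eaSumListDefined A (chainSortR A.le C) ∧
    EAMon.mk A (eaM A C) = ∑ k ∈ (Finset.range N).filter
      (fun k => Odd (C.filter fun x => ¬ x ≤ q k).card), f k := by
  have hperm : (chainSortR A.le C).Perm C.toList := List.mergeSort_perm _ _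
  have hs : (chainSortR A.le C).Pairwise A.le := by
    refine kh_sort A.le C.toList ?_ ?_
    · intro a ha b hb
      rw [hle, hle]
      exact hC.1 a (by simpa using ha) b (by simpa using hb)
    · intro a _ b _ c _
      rw [hle, hle, hle]; exact le_trans
  obtain ⟨n, hn⟩ := hC.2
  have hmem : ∀ x ∈ chainSortR A.le C, x ∈ C := fun x h => by
    simpa using hperm.mem_iff.1 h
  have key := kh_key A N f hN (fun x : P => x)
    (fun x => (Finset.range N).filter (fun k => ¬ x ≤ q k)) n (chainSortR A.le C)
    (by rw [hperm.length_eq, Finset.length_toList]; omega)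
    (hs.imp (by
      intro a b hab k hk
      rw [Finset.mem_filter] at hk ⊢
      exact ⟨hk.1, fun h => hk.2 (((hle _ _).1 hab).trans h)⟩))
    (fun i _ => Finset.filter_subset _ _)
    (fun i hi => hx i (hmem i hi))
  rw [List.map_id'] at key
  refine ⟨key.1, key.2.trans ?_⟩
  refine Finset.sum_congr ?_ fun _ _ => rfl
  refine Finset.filter_congr fun k hk => ?_
  rw [kh_count C _ hperm (fun x => ¬ x ≤ q k) _ (by
    intro x; rw [decide_eq_true_iff, Finset.mem_filter]; simp only [hk, true_and])]

end Helpers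

/-- For every effect algebra `A` (on a bounded poset), the map
`m_A [x₁<x₂<…<x_{2n}] = (x₂ ⊖ x₁) ⊕ … ⊕ (x_{2n} ⊖ x_{2n-1})`, `m_A ∅ = 0`, is well
defined (all indicated sums exist) and makes the underlying bounded poset of `A`
into an Eilenberg-Moore algebra for the Kalmbach monad. -/
theorem effect_algebra_structure_map_is_EM_algebra
    (P : Type u) [PartialOrder P] [BoundedOrder P] [Nontrivial P]
    (A : EffectAlgebra P) (h0 : A.zero = ⊥) (h1 : A.one = ⊤)
    (hle : ∀ a b : P, A.le a b ↔ a ≤ b) :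
    (∀ C ∈ KalCarrier Set.univ ((· ≤ ·) : P → P → Prop),
        eaSumListDefined A (chainSortR A.le C)) ∧
    eaM A ∅ = A.zero ∧
    IsEMAlgebra P (eaM A) := by
  have hdef : ∀ C ∈ KalCarrier Set.univ ((· ≤ ·) : P → P → Prop),
      eaSumListDefined A (chainSortR A.le C) := by
    intro C hC
    obtain ⟨N, f, q, hN, hx⟩ := kh_grid A h0 hle C hC.2.1
    exact (kh_chain A hle N f q hN C hC.2 hx).1
  have hempty : eaM A ∅ = A.zero := by
    simp [eaM, chainSortR, eaSumList]
  have hmono : ∀ C ∈ KalCarrier Set.univ ((· ≤ ·) : P → P → Prop),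
     ∀ D ∈ KalCarrier Set.univ ((· ≤ ·) : P → P → Prop),
       KalLER (· ≤ ·) C D → eaM A C ≤ eaM A D := by
    intro C hC D hD hCD
    obtain ⟨N, f, q, hN, hx⟩ := kh_grid A h0 hle (C ∪ D) (by
      intro a ha b hb
      rcases Finset.mem_union.1 ha with ha | ha <;> rcases Finset.mem_union.1 hb with hb | hb
      · exact hC.2.1 a ha b hb
      · exact kh_comparable C D hC.2 hD.2 hCD a b ha hb
      · exact (kh_comparable C D hC.2 hD.2 hCD b a hb ha).symm
      · exact hD.2.1 a ha b hb)
    have e1 := (kh_chain A hle N f q hN C hC.2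
      (fun x h => hx x (Finset.mem_union_left _ h))).2
    have e2 := (kh_chain A hle N f q hN D hD.2
      (fun x h => hx x (Finset.mem_union_right _ h))).2
    refine (hle _ _).1 (kh_subset_le A f ?_ e1 e2).1
    intro k hk
    rw [Finset.mem_filter] at hk ⊢
    exact ⟨hk.1, kh_le_odd C D hC.2 hD.2 hCD (q k) hk.2⟩
  have heta : ∀ a : P, eaM A (kalEtaF ⊥ a) = a := by
    intro a
    unfold kalEtaF
    split_ifs with ha
    · rw [hempty, ha, h0]
    · have hc : ∀ x ∈ ({⊥, a} : Finset P), ∀ y ∈ ({⊥, a} : Finset P), x ≤ y ∨ y ≤ x := by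
        intro x hx y hy
        simp only [Finset.mem_insert, Finset.mem_singleton] at hx hy
        rcases hx with rfl | rfl <;> rcases hy with rfl | rfl <;> simp
      obtain ⟨N, f, q, hN, hx⟩ := kh_grid A h0 hle _ hc
      have e := (kh_chain A hle N f q hN _ ⟨hc, by
        rw [Finset.card_pair (Ne.symm ha)]; exact even_two⟩ hx).2
      apply kh_mk_inj A
      rw [e, hx a (by simp)]
      refine Finset.sum_congr ?_ fun _ _ => rfl
      refine Finset.filter_congr fun k _ => ?_
      by_cases h : a ≤ q k <;> simp [Finset.filter_insert, Finset.filter_singleton, h]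
  refine ⟨hdef, hempty, hmono, hempty.trans h0, ?_, heta, ?_⟩
  · have := heta ⊤
    rwa [kalEtaF, if_neg top_ne_bot] at this
  · intro 𝒞 h𝒞
    obtain ⟨hsub, htot, hev⟩ := h𝒞
    have hK : ∀ C ∈ 𝒞, C ∈ KalCarrier Set.univ ((· ≤ ·) : P → P → Prop) := fun C hC => hsub hC
    -- the union is a chain
    have hU : ∀ a ∈ 𝒞.sup id, ∀ b ∈ 𝒞.sup id, a ≤ b ∨ b ≤ a := by
      intro a ha b hb
      rw [Finset.mem_sup] at ha hb
      obtain ⟨C, hC, ha⟩ := ha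
      obtain ⟨D, hD, hb⟩ := hb
      rcases htot C hC D hD with h | h
      · exact kh_comparable C D (hK C hC).2 (hK D hD).2 h a b ha hb
      · exact (kh_comparable D C (hK D hD).2 (hK C hC).2 h b a hb ha).symm
    obtain ⟨N, f, q, hN, hx⟩ := kh_grid A h0 hle _ hU
    have hmu : IsEvenChainR (· ≤ ·) (kalMuF 𝒞) := by
      refine ⟨fun a ha b hb => hU a (Finset.mem_filter.1 ha).1 b (Finset.mem_filter.1 hb).1, ?_⟩
      rw [← Nat.not_odd_iff_even]
      have := kh_mu_parity 𝒞 (fun _ => True)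
      rw [Finset.filter_true] at this
      rw [this]
      rw [Finset.filter_eq_empty_iff.2]
      · simp
      · intro C hC
        rw [Finset.filter_true]
        exact Nat.not_odd_iff_even.2 (hK C hC).2.2
    have emu := (kh_chain A hle N f q hN _ hmu (fun x h => hx x (Finset.mem_filter.1 h).1)).2
    -- the members
    set T : Finset P → Finset ℕ := fun C => (Finset.range N).filter
      (fun k => Odd (C.filter fun x => ¬ x ≤ q k).card) with hT
    have eC : ∀ C ∈ 𝒞, EAMon.mk A (eaM A C) = ∑ k ∈ T C, f k := fun C hC =>
      (kh_chain A hle N f q hN C (hK C hC).2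
        (fun x h => hx x (Finset.mem_sup.2 ⟨C, hC, h⟩))).2
    have hTle : ∀ C ∈ 𝒞, ∀ D ∈ 𝒞, KalLER (· ≤ ·) C D → T C ⊆ T D := by
      intro C hC D hD h k hk
      rw [hT, Finset.mem_filter] at hk ⊢
      exact ⟨hk.1, kh_le_odd C D (hK C hC).2 (hK D hD).2 h (q k) hk.2⟩
    -- sort
    obtain ⟨l, hperm, hsort⟩ : ∃ l : List (Finset P), l.Perm 𝒞.toList ∧
        l.Pairwise (fun C D => T C ⊆ T D) := by
      refine ⟨_, List.mergeSort_perm _ _, kh_sort (fun C D => T C ⊆ T D) 𝒞.toList ?_ ?_⟩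
      · intro C hC D hD
        rw [Finset.mem_toList] at hC hD
        exact (htot C hC D hD).imp (hTle C hC D hD) (hTle D hD C hC)
      · intro a _ b _ c _ h1 h2
        exact h1.trans h2
    have hlmem : ∀ C ∈ l, C ∈ 𝒞 := fun C h => by simpa using hperm.mem_iff.1 h
    obtain ⟨n, hn⟩ := hev
    have hlen : l.length = 2 * n := by rw [hperm.length_eq, Finset.length_toList]; omega
    have key1 := (kh_key A N f hN (eaM A) T n l hlen hsort
      (fun i _ => Finset.filter_subset _ _) (fun C h => eC C (hlmem C h))).2
    have r1 : eaSumList A (l.map (eaM A)) = eaM A (kalMuF 𝒞) := by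
      apply kh_mk_inj A
      rw [key1, emu]
      refine Finset.sum_congr ?_ fun _ _ => rfl
      refine Finset.filter_congr fun k hk => ?_
      rw [kh_mu_parity, kh_count 𝒞 l hperm (fun C => Odd (C.filter fun x => ¬ x ≤ q k).card) _ (by
        intro x; rw [decide_eq_true_iff, hT, Finset.mem_filter]; simp only [hk, true_and])]
    -- the image side
    have hI : ∀ a ∈ 𝒞.image (eaM A), ∀ b ∈ 𝒞.image (eaM A), a ≤ b ∨ b ≤ a := by
      intro a ha b hb
      obtain ⟨C, hC, rfl⟩ := Finset.mem_image.1 ha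
      obtain ⟨D, hD, rfl⟩ := Finset.mem_image.1 hb
      exact (htot C hC D hD).imp (hmono C (hK C hC) D (hK D hD))
        (hmono D (hK D hD) C (hK C hC))
    obtain ⟨N', f', q', hN', hx'⟩ := kh_grid A h0 hle _ hI
    have hmap : IsEvenChainR (· ≤ ·) (kalMapF (eaM A) 𝒞) := by
      refine ⟨fun a ha b hb => hI a (Finset.mem_filter.1 ha).1 b (Finset.mem_filter.1 hb).1, ?_⟩
      rw [← Nat.not_odd_iff_even]
      have := kh_map_parity (eaM A) 𝒞 (fun _ => True)
      rw [Finset.filter_true, Finset.filter_true] at this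
      rw [this, Nat.not_odd_iff_even]
      exact ⟨n, hn⟩
    have emap := (kh_chain A hle N' f' q' hN' _ hmap
      (fun x h => hx' x (Finset.mem_filter.1 h).1)).2
    have hsort' : l.Pairwise (fun C D => eaM A C ≤ eaM A D) := by
      refine hsort.imp_of_mem ?_
      intro C D hC hD h
      exact (hle _ _).1 (kh_subset_le A f h (eC C (hlmem C hC)) (eC D (hlmem D hD))).1
    have key2 := (kh_key A N' f' hN' (eaM A)
      (fun C => (Finset.range N').filter (fun k => ¬ eaM A C ≤ q' k)) n l hlen
      (hsort'.imp (by
        intro C D hCD k hk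
        rw [Finset.mem_filter] at hk ⊢
        exact ⟨hk.1, fun h => hk.2 (hCD.trans h)⟩))
      (fun i _ => Finset.filter_subset _ _)
      (fun C h => hx' _ (Finset.mem_image_of_mem _ (hlmem C h)))).2
    rw [← r1]
    apply kh_mk_inj A
    rw [key2, emap]
    refine Finset.sum_congr ?_ fun _ _ => rfl
    refine Finset.filter_congr fun k hk => ?_
    rw [kh_map_parity, kh_count 𝒞 l hperm (fun C => ¬ eaM A C ≤ q' k) _ (by
      intro x; rw [decide_eq_true_iff, Finset.mem_filter]; simp only [hk, true_and])]
end

section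
/- Let (A,α) be an Eilenberg-Moore algebra for the Kalmbach monad. Define a partial operation ⊖ on the bounded poset A by: b⊖a is defined iff a ≤ b, with b⊖a = 0 if a = b and b⊖a = α([a<b]) if a < b. Then (A,≤,⊖,0,1) is a D-poset. -/
attribute [local instance] Classical.propDecidable

universe u v w

/-- The difference operation of an Eilenberg-Moore algebra `(P, m)`:
`b ⊖ a = 0` if `a = b`, and `b ⊖ a = m [a < b]` if `a < b` (junk otherwise;
its intended domain is `a ≤ b`). -/
noncomputable def emSub {P : Type u} [PartialOrder P] [BoundedOrder P]
    (m : Finset P → P) (b a : P) : P :=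
  if a = b then ⊥ else m {a, b}

theorem kal_sd_eq {P : Type u} (a b : P) (h : a ≠ b) :
    symmDiff ({a} : Finset P) {b} = {a, b} := by
  ext x
  simp only [Finset.mem_symmDiff, Finset.mem_singleton, Finset.mem_insert]
  grind

theorem kal_emSub_eq {P : Type u} [PartialOrder P] [BoundedOrder P]
    (m : Finset P → P) (h0 : m ∅ = ⊥) (a b : P) :
    emSub m b a = m (symmDiff {a} {b}) := by
  unfold emSub
  split_ifs with h
  · subst h
    rw [symmDiff_self]
    exact h0.symm
  · rw [kal_sd_eq a b h]

theorem kal_sd_carrier {P : Type u} [PartialOrder P] (a b : P) (h : a ≤ b) :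
    symmDiff ({a} : Finset P) {b} ∈ KalCarrier Set.univ ((· ≤ ·) : P → P → Prop) := by
  refine ⟨Set.subset_univ _, ?_⟩
  by_cases hab : a = b
  · subst hab
    rw [symmDiff_self]
    simp [IsEvenChainR]
  · rw [kal_sd_eq a b hab]
    refine ⟨?_, ?_⟩
    · intro x hx y hy
      simp only [Finset.mem_insert, Finset.mem_singleton] at hx hy
      rcases hx with rfl | rfl <;> rcases hy with rfl | rfl <;> simp [h]
    · rw [Finset.card_pair hab]
      exact even_two

theorem kal_sd_pair {P : Type u} [PartialOrder P] (a b : P) (h : a ≤ b) (hab : a ≠ b) :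
    KalPairR (· ≤ ·) (symmDiff ({a} : Finset P) {b}) a b := by
  rw [kal_sd_eq a b hab]
  have hba : ¬ b ≤ a := fun h' => hab (le_antisymm h h')
  refine ⟨by simp, by simp, h, hab, ?_, ?_⟩
  · have : (({a, b} : Finset P).filter fun y => y ≤ a) = {a} := by
      ext x
      simp only [Finset.mem_filter, Finset.mem_insert, Finset.mem_singleton]
      constructor
      · rintro ⟨rfl | rfl, hx⟩
        · rfl
        · exact absurd hx hba
      · rintro rfl
        exact ⟨Or.inl rfl, le_rfl⟩
    rw [this]
    simp
  · intro c hc _ hca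
    simp only [Finset.mem_insert, Finset.mem_singleton] at hc
    rcases hc with rfl | rfl
    · exact absurd rfl hca
    · exact le_rfl

theorem kal_sd_le {P : Type u} [PartialOrder P] (a b c d : P) (h : a ≤ b)
    (hca : c ≤ a) (hbd : b ≤ d) :
    KalLER ((· ≤ ·) : P → P → Prop) (symmDiff {a} {b}) (symmDiff {c} {d}) := by
  rintro x y ⟨hx, hy, hxy, hne, -, -⟩
  by_cases hab : a = b
  · subst hab
    rw [symmDiff_self] at hx
    simp at hx
  · have hcd : c ≠ d := by
      rintro rfl
      exact hab (le_antisymm h (hbd.trans hca))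
    refine ⟨c, d, kal_sd_pair c d (hca.trans (h.trans hbd)) hcd, ?_, ?_⟩
    · rw [kal_sd_eq a b hab] at hx
      simp only [Finset.mem_insert, Finset.mem_singleton] at hx
      rcases hx with rfl | rfl
      · exact hca
      · exact hca.trans h
    · rw [kal_sd_eq a b hab] at hy
      simp only [Finset.mem_insert, Finset.mem_singleton] at hy
      rcases hy with rfl | rfl
      · exact h.trans hbd
      · exact hbd

theorem kal_odd_filter_pair {P : Type u} [DecidableEq P] (C D : P) (h : C ≠ D) (p : P → Prop)
    [DecidablePred p] :
    Odd (({C, D} : Finset P).filter p).card ↔ (p C ∧ ¬ p D) ∨ (p D ∧ ¬ p C) := by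
  by_cases h1 : p C <;> by_cases h2 : p D <;>
    simp [Finset.filter_insert, Finset.filter_singleton, h1, h2, h]

theorem kal_mu_pair {P : Type u} (C D : Finset P) (h : C ≠ D) :
    kalMuF {C, D} = symmDiff C D := by
  ext x
  unfold kalMuF
  rw [Finset.mem_filter, kal_odd_filter_pair C D h, Finset.mem_symmDiff]
  simp only [Finset.mem_sup, Finset.mem_insert, Finset.mem_singleton, id]
  constructor
  · exact fun h => h.2
  · rintro (h | h)
    · exact ⟨⟨C, Or.inl rfl, h.1⟩, Or.inl h⟩
    · exact ⟨⟨D, Or.inr rfl, h.1⟩, Or.inr h⟩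

theorem kal_map_pair {P : Type u} (m : Finset P → P) (C D : Finset P) (h : C ≠ D) :
    kalMapF m {C, D} = symmDiff {m C} {m D} := by
  ext x
  unfold kalMapF
  rw [Finset.mem_filter, kal_odd_filter_pair C D h, Finset.mem_symmDiff]
  simp only [Finset.mem_image, Finset.mem_insert, Finset.mem_singleton]
  grind

theorem kal_key {P : Type u} [PartialOrder P] [BoundedOrder P]
    (m : Finset P → P) (hm : IsEMAlgebra P m) (C D : Finset P)
    (hC : C ∈ KalCarrier Set.univ ((· ≤ ·) : P → P → Prop))
    (hD : D ∈ KalCarrier Set.univ ((· ≤ ·) : P → P → Prop))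
    (hCD : KalLER ((· ≤ ·) : P → P → Prop) C D) :
    emSub m (m D) (m C) = m (symmDiff C D) := by
  obtain ⟨-, h0, -, -, hmu⟩ := hm
  rw [kal_emSub_eq m h0]
  by_cases h : C = D
  · subst h
    rw [symmDiff_self, symmDiff_self]
  · rw [← kal_mu_pair C D h, ← kal_map_pair m C D h]
    apply hmu
    have hr : ∀ E : Finset P, KalLER ((· ≤ ·) : P → P → Prop) E E :=
      fun E a b hab => ⟨a, b, hab, le_rfl, le_rfl⟩
    refine ⟨?_, ?_, ?_⟩
    · intro E hE
      simp only [Finset.coe_insert, Finset.coe_singleton, Set.mem_insert_iff,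
        Set.mem_singleton_iff] at hE
      rcases hE with rfl | rfl <;> assumption
    · intro E hE F hF
      simp only [Finset.mem_insert, Finset.mem_singleton] at hE hF
      rcases hE with rfl | rfl <;> rcases hF with rfl | rfl
      · exact Or.inl (hr _)
      · exact Or.inl hCD
      · exact Or.inr hCD
      · exact Or.inl (hr _)
    · rw [Finset.card_pair h]
      exact even_two

/-- Let `(P, m)` be an Eilenberg-Moore algebra for the Kalmbach
monad.  Then `P`, with `b ⊖ a` defined for `a ≤ b` by `b ⊖ a = 0` if `a = b` and
`b ⊖ a = m [a < b]` if `a < b`, is a D-poset. -/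
theorem EM_algebra_gives_DPoset
    (P : Type u) [PartialOrder P] [BoundedOrder P] [Nontrivial P]
    (m : Finset P → P) (hm : IsEMAlgebra P m) :
    ∃ Dp : DPoset P, (∀ a b : P, Dp.le a b ↔ a ≤ b) ∧ Dp.zero = ⊥ ∧ Dp.one = ⊤ ∧
      (∀ a b : P, Dp.Ddef b a ↔ a ≤ b) ∧
      ∀ a b : P, a ≤ b → Dp.diff b a = emSub m b a := by
  have hm' := hm
  obtain ⟨hmono, h0, h1, heta, -⟩ := hm'
  have hbot : ∀ b : P, m (symmDiff {⊥} {b}) = b := by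
    intro b
    rw [← kal_emSub_eq m h0]
    have := heta b
    unfold kalEtaF at this
    unfold emSub
    by_cases hb : b = ⊥
    · rw [if_pos hb.symm, hb]
    · rw [if_neg hb] at this
      rw [if_neg (Ne.symm hb), this]
  have hle : ∀ a b c d : P, a ≤ b → c ≤ a → b ≤ d →
      m (symmDiff {a} {b}) ≤ m (symmDiff {c} {d}) := fun a b c d h hca hbd =>
    hmono _ (kal_sd_carrier a b h) _ (kal_sd_carrier c d (hca.trans (h.trans hbd)))
      (kal_sd_le a b c d h hca hbd)
  have hsub : ∀ a b c : P, a ≤ b → b ≤ c →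
      emSub m (m (symmDiff {a} {c})) (m (symmDiff {b} {c})) = m (symmDiff {a} {b}) := by
    intro a b c hab hbc
    rw [kal_key m hm _ _ (kal_sd_carrier b c hbc) (kal_sd_carrier a c (hab.trans hbc))
      (kal_sd_le b c a c hbc hab le_rfl)]
    congr 1
    ext x
    simp only [Finset.mem_symmDiff, Finset.mem_singleton]
    tauto
  refine ⟨{
    le := (· ≤ ·)
    zero := ⊥
    one := ⊤
    Ddef := fun b a => a ≤ b
    diff := emSub m
    le_refl := fun a => le_rfl
    le_antisymm := fun h h' => le_antisymm h h'
    le_trans := fun h h' => le_trans h h'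
    zero_le := fun a => bot_le
    le_one := fun a => le_top
    d1 := fun a b => Iff.rfl
    d2a := ?_
    d2b := ?_
    d3a := ?_
    d3b := ?_ }, fun _ _ => Iff.rfl, rfl, rfl, fun _ _ => Iff.rfl, fun _ _ _ => rfl⟩
  · intro a b h
    rw [kal_emSub_eq m h0]
    exact (hle a b ⊥ b h bot_le le_rfl).trans (hbot b).le
  · intro a b h
    have := hsub ⊥ a b bot_le h
    rw [hbot, hbot] at this
    rw [kal_emSub_eq m h0 a b]
    exact this
  · intro a b c hab hbc
    rw [kal_emSub_eq m h0, kal_emSub_eq m h0]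
    exact hle b c a c hbc hab le_rfl
  · intro a b c hab hbc
    rw [kal_emSub_eq m h0 a c, kal_emSub_eq m h0 b c, kal_emSub_eq m h0 a b]
    exact hsub a b c hab hbc
end
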